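/- Long-time convergence when the ergodic constant is negative: let m > 2, f ∈ C(Ω̄), u₀ ∈ C(Ω̄) and g ∈ C(∂Ω) with u₀ = g on ∂Ω, and let u be the unique continuous viscosity solution of E(Ω,f,g,u₀,0). Let c ∈ ℝ be the ergodic constant, i.e. the unique constant for which Erg(Ω,f,c) has a viscosity solution that is Hölder continuous on Ω̄ with exponent (m−2)/(m−1) and locally Lipschitz in Ω. If c < 0, then u is uniformly bounded on Ω̄ × [0,+∞) and u(·,t) converges uniformly on Ω̄, as t → +∞, to u₂, the unique bounded continuous viscosity solution of the generalized Dirichlet problem S(Ω,f,g,0). -/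

import Mathlib

open Set Filter Topology Metric MeasureTheory

noncomputable section

/-- Euclidean space `ℝ^N`. -/
abbrev Euc (N : ℕ) : Type := EuclideanSpace ℝ (Fin N)

/-- The Laplacian of `φ` at `x`, computed as the trace of the second derivative
in the standard orthonormal basis of `ℝ^N`. -/
noncomputable def lapl {N : ℕ} (φ : Euc N → ℝ) (x : Euc N) : ℝ :=
  ∑ i : Fin N,
    iteratedFDeriv ℝ 2 φ x ![EuclideanSpace.single i 1, EuclideanSpace.single i 1]

/-- `Ω` is a domain with `C²` boundary: it is the sublevel set of a `C²`
defining function whose gradient does not vanish on the boundary. -/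
def HasC2Boundary {N : ℕ} (Ω : Set (Euc N)) : Prop :=
  ∃ ρ : Euc N → ℝ, ContDiff ℝ 2 ρ ∧ Ω = {x | ρ x < 0} ∧
    frontier Ω = {x | ρ x = 0} ∧ ∀ x ∈ frontier Ω, gradient ρ x ≠ 0

/-- The stationary operator `−Δφ(x) + |Dφ(x)|^m + λ r − h(x)` evaluated with the
value `r` of the (sub/super)solution at `x`. -/
noncomputable def statOp {N : ℕ} (h : Euc N → ℝ) (lam m : ℝ)
    (φ : Euc N → ℝ) (r : ℝ) (x : Euc N) : ℝ :=
  -lapl φ x + ‖gradient φ x‖ ^ m + lam * r - h x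

/-- Viscosity subsolution of the generalized Dirichlet problem
`S(Ω,h,k,λ)`: `−Δw + |Dw|^m + λ w = h` in `Ω`, `w = k` on `∂Ω`. -/
def IsStatSub {N : ℕ} (Ω : Set (Euc N)) (h k : Euc N → ℝ) (lam m : ℝ)
    (u : Euc N → ℝ) : Prop :=
  UpperSemicontinuousOn u (closure Ω) ∧
  ∀ φ : Euc N → ℝ, ContDiff ℝ 2 φ → ∀ x₀ ∈ closure Ω,
    IsLocalMaxOn (u - φ) (closure Ω) x₀ →
      (x₀ ∈ Ω → statOp h lam m φ (u x₀) x₀ ≤ 0) ∧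
      (x₀ ∈ frontier Ω → min (statOp h lam m φ (u x₀) x₀) (u x₀ - k x₀) ≤ 0)

/-- Viscosity supersolution of the generalized Dirichlet problem `S(Ω,h,k,λ)`. -/
def IsStatSuper {N : ℕ} (Ω : Set (Euc N)) (h k : Euc N → ℝ) (lam m : ℝ)
    (v : Euc N → ℝ) : Prop :=
  LowerSemicontinuousOn v (closure Ω) ∧
  ∀ φ : Euc N → ℝ, ContDiff ℝ 2 φ → ∀ x₀ ∈ closure Ω,
    IsLocalMinOn (v - φ) (closure Ω) x₀ →
      (x₀ ∈ Ω → 0 ≤ statOp h lam m φ (v x₀) x₀) ∧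
      (x₀ ∈ frontier Ω → 0 ≤ max (statOp h lam m φ (v x₀) x₀) (v x₀ - k x₀))

/-- The parabolic operator
`φ_t(x,t) − Δφ(·,t)(x) + |Dφ(·,t)(x)|^m + λ r − f(x)`. -/
noncomputable def parOp {N : ℕ} (f : Euc N → ℝ) (lam m : ℝ)
    (φ : Euc N × ℝ → ℝ) (r : ℝ) (x : Euc N) (t : ℝ) : ℝ :=
  deriv (fun s => φ (x, s)) t - lapl (fun y => φ (y, t)) x
    + ‖gradient (fun y => φ (y, t)) x‖ ^ m + lam * r - f x

/-- Viscosity subsolution of the generalized initial-boundary value problem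
`E(Ω,f,g,u₀,λ)` on the time interval `[0,T]`:
`u_t − Δu + |Du|^m + λ u = f` in `Ω × (0,T]`, `u = g` on `∂Ω × (0,T]`,
`u(·,0) = u₀` on `closure Ω`. -/
def IsParSub {N : ℕ} (Ω : Set (Euc N)) (f g u₀ : Euc N → ℝ) (lam m T : ℝ)
    (u : Euc N → ℝ → ℝ) : Prop :=
  UpperSemicontinuousOn (fun p : Euc N × ℝ => u p.1 p.2) (closure Ω ×ˢ Ico 0 T) ∧
  (∀ x ∈ closure Ω, u x 0 ≤ u₀ x) ∧
  ∀ φ : Euc N × ℝ → ℝ, ContDiff ℝ 2 φ → ∀ x₀ : Euc N, ∀ t₀ : ℝ,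
    (x₀, t₀) ∈ closure Ω ×ˢ Ioc 0 T →
    IsLocalMaxOn (fun p : Euc N × ℝ => u p.1 p.2 - φ p) (closure Ω ×ˢ Ioc 0 T) (x₀, t₀) →
      (x₀ ∈ Ω → parOp f lam m φ (u x₀ t₀) x₀ t₀ ≤ 0) ∧
      (x₀ ∈ frontier Ω →
        min (parOp f lam m φ (u x₀ t₀) x₀ t₀) (u x₀ t₀ - g x₀) ≤ 0)

/-- Viscosity supersolution of `E(Ω,f,g,u₀,λ)` on the time interval `[0,T]`. -/
def IsParSuper {N : ℕ} (Ω : Set (Euc N)) (f g u₀ : Euc N → ℝ) (lam m T : ℝ)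
    (v : Euc N → ℝ → ℝ) : Prop :=
  LowerSemicontinuousOn (fun p : Euc N × ℝ => v p.1 p.2) (closure Ω ×ˢ Icc 0 T) ∧
  (∀ x ∈ closure Ω, u₀ x ≤ v x 0) ∧
  ∀ φ : Euc N × ℝ → ℝ, ContDiff ℝ 2 φ → ∀ x₀ : Euc N, ∀ t₀ : ℝ,
    (x₀, t₀) ∈ closure Ω ×ˢ Ioc 0 T →
    IsLocalMinOn (fun p : Euc N × ℝ => v p.1 p.2 - φ p) (closure Ω ×ˢ Ioc 0 T) (x₀, t₀) →
      (x₀ ∈ Ω → 0 ≤ parOp f lam m φ (v x₀ t₀) x₀ t₀) ∧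
      (x₀ ∈ frontier Ω →
        0 ≤ max (parOp f lam m φ (v x₀ t₀) x₀ t₀) (v x₀ t₀ - g x₀))

/-- A continuous viscosity solution, global in time, of `E(Ω,f,g,u₀,λ)`. -/
def IsGlobalParSol {N : ℕ} (Ω : Set (Euc N)) (f g u₀ : Euc N → ℝ) (lam m : ℝ)
    (u : Euc N → ℝ → ℝ) : Prop :=
  ContinuousOn (fun p : Euc N × ℝ => u p.1 p.2) (closure Ω ×ˢ Ici 0) ∧
  ∀ T > (0 : ℝ), IsParSub Ω f g u₀ lam m T u ∧ IsParSuper Ω f g u₀ lam m T u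

open scoped Classical in
/-- Redefinition of a parabolic subsolution on the lateral boundary by its
`limsup` from inside `Ω × (0,T]`. -/
noncomputable def uscExtPar {N : ℕ} (Ω : Set (Euc N)) (T : ℝ)
    (u : Euc N → ℝ → ℝ) : Euc N → ℝ → ℝ :=
  fun z t => if z ∈ Ω then u z t
    else limsup (fun p : Euc N × ℝ => u p.1 p.2) (𝓝[Ω ×ˢ Ioc 0 T] (z, t))

open scoped Classical in
/-- Redefinition of a stationary subsolution on the boundary by its `limsup`
from inside `Ω`. -/
noncomputable def uscExtStat {N : ℕ} (Ω : Set (Euc N))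
    (u : Euc N → ℝ) : Euc N → ℝ :=
  fun z => if z ∈ Ω then u z else limsup u (𝓝[Ω] z)

/-- Continuous viscosity solution of the state constraint problem
`−Δw + |Dw|^m + λ w = h` in `Ω`, `−Δw + |Dw|^m + λ w ≥ h` on `∂Ω`. -/
def IsSCSolution {N : ℕ} (Ω : Set (Euc N)) (h : Euc N → ℝ) (lam m : ℝ)
    (w : Euc N → ℝ) : Prop :=
  ContinuousOn w (closure Ω) ∧
  (∀ φ : Euc N → ℝ, ContDiff ℝ 2 φ → ∀ x₀ ∈ Ω, IsLocalMaxOn (w - φ) Ω x₀ →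
      statOp h lam m φ (w x₀) x₀ ≤ 0) ∧
  (∀ φ : Euc N → ℝ, ContDiff ℝ 2 φ → ∀ x₀ ∈ closure Ω,
      IsLocalMinOn (w - φ) (closure Ω) x₀ → 0 ≤ statOp h lam m φ (w x₀) x₀)

/-- Continuous viscosity subsolution of `−Δu + |Du|^m ≤ h` in `Ω`
(no boundary condition). -/
def IsIntSub {N : ℕ} (Ω : Set (Euc N)) (h : Euc N → ℝ) (m : ℝ)
    (u : Euc N → ℝ) : Prop :=
  ∀ φ : Euc N → ℝ, ContDiff ℝ 2 φ → ∀ x₀ ∈ Ω, IsLocalMaxOn (u - φ) Ω x₀ →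
    statOp h 0 m φ (u x₀) x₀ ≤ 0

/-- Hölder continuity with exponent `α` on a set. -/
def HolderOnCl {N : ℕ} (α : ℝ) (s : Set (Euc N)) (w : Euc N → ℝ) : Prop :=
  ∃ C > (0 : ℝ), ∀ x ∈ s, ∀ y ∈ s, |w x - w y| ≤ C * ‖x - y‖ ^ α

/-- Local Lipschitz continuity inside `Ω`. -/
def LocLipIn {N : ℕ} (Ω : Set (Euc N)) (w : Euc N → ℝ) : Prop :=
  ∀ x ∈ Ω, ∃ ε > (0 : ℝ), ∃ K : ℝ, 0 ≤ K ∧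
    ∀ y ∈ ball x ε ∩ Ω, ∀ z ∈ ball x ε ∩ Ω, |w y - w z| ≤ K * ‖y - z‖

/-- A piecewise `C¹` path parametrized on `[0,1]`. -/
def IsPWC1Path {N : ℕ} (γ : ℝ → Euc N) : Prop :=
  ContinuousOn γ (Icc 0 1) ∧
  ∃ n : ℕ, ∃ τ : Fin (n + 1) → ℝ, StrictMono τ ∧ τ 0 = 0 ∧ τ (Fin.last n) = 1 ∧
    ∀ i : Fin n, ContDiffOn ℝ 1 γ (Icc (τ i.castSucc) (τ i.succ))

/-- The length of a path on `[0,1]`. -/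
noncomputable def pathLen {N : ℕ} (γ : ℝ → Euc N) : ℝ :=
  ∫ t in (0 : ℝ)..1, ‖derivWithin γ (Icc (0 : ℝ) 1) t‖

/-- The geodesic-type distance inside `closure S` via piecewise `C¹` paths. -/
noncomputable def dTilde {N : ℕ} (S : Set (Euc N)) (x y : Euc N) : ℝ :=
  sInf {L : ℝ | ∃ γ : ℝ → Euc N, IsPWC1Path γ ∧ γ 0 = x ∧ γ 1 = y ∧
    MapsTo γ (Icc 0 1) (closure S) ∧ L = pathLen γ}

/-- The inner parallel set `Ω_δ = {x ∈ Ω : dist(x,∂Ω) > δ}`. -/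
def innerSet {N : ℕ} (Ω : Set (Euc N)) (δ : ℝ) : Set (Euc N) :=
  {x ∈ Ω | δ < infDist x (frontier Ω)}

end


open Set Filter Topology Metric MeasureTheory

noncomputable section

/-- time derivative -/
def dtE {N : ℕ} (φ : Euc N × ℝ → ℝ) (p : Euc N × ℝ) : ℝ := deriv (fun s => φ (p.1, s)) p.2
/-- space gradient -/
def grE {N : ℕ} (φ : Euc N × ℝ → ℝ) (p : Euc N × ℝ) : Euc N :=
  gradient (fun y => φ (y, p.2)) p.1
/-- space Laplacian -/
def lpE {N : ℕ} (φ : Euc N × ℝ → ℝ) (p : Euc N × ℝ) : ℝ := lapl (fun y => φ (y, p.2)) p.1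

lemma parOp_eq {N : ℕ} (f : Euc N → ℝ) (m : ℝ) (φ : Euc N × ℝ → ℝ) (r : ℝ) (x : Euc N) (t : ℝ) :
    parOp f 0 m φ r x t = dtE φ (x, t) - lpE φ (x, t) + ‖grE φ (x, t)‖ ^ m - f x := by
  simp [parOp, dtE, lpE, grE]

lemma lapl_eq_laplacian {N : ℕ} (φ : Euc N → ℝ) (x : Euc N) :
    lapl φ x = Laplacian.laplacian φ x := by
  rw [congrFun (InnerProductSpace.laplacian_eq_iteratedFDeriv_orthonormalBasis φ
    (EuclideanSpace.basisFun (Fin N) ℝ)) x]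
  simp [lapl]

lemma slice_x {N : ℕ} {φ : Euc N × ℝ → ℝ} (h : ContDiff ℝ 2 φ) (t : ℝ) :
    ContDiff ℝ 2 (fun y => φ (y, t)) :=
  h.comp (contDiff_id.prodMk contDiff_const)

lemma slice_t {N : ℕ} {φ : Euc N × ℝ → ℝ} (h : ContDiff ℝ 2 φ) (x : Euc N) :
    ContDiff ℝ 2 (fun s => φ (x, s)) :=
  h.comp (contDiff_const.prodMk contDiff_id)

lemma slice_xd {N : ℕ} {φ : Euc N × ℝ → ℝ} (h : ContDiff ℝ 2 φ) (p : Euc N × ℝ) :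
    DifferentiableAt ℝ (fun y => φ (y, p.2)) p.1 :=
  ((slice_x h p.2).differentiable (by norm_num)).differentiableAt

lemma slice_td {N : ℕ} {φ : Euc N × ℝ → ℝ} (h : ContDiff ℝ 2 φ) (p : Euc N × ℝ) :
    DifferentiableAt ℝ (fun s => φ (p.1, s)) p.2 :=
  ((slice_t h p.1).differentiable (by norm_num)).differentiableAt

section lin
variable {N : ℕ} {φ ψ : Euc N × ℝ → ℝ}

lemma dtE_add (h : ContDiff ℝ 2 φ) (h' : ContDiff ℝ 2 ψ) (p : Euc N × ℝ) :
    dtE (fun q => φ q + ψ q) p = dtE φ p + dtE ψ p :=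
  deriv_fun_add (slice_td h p) (slice_td h' p)

lemma grE_add (h : ContDiff ℝ 2 φ) (h' : ContDiff ℝ 2 ψ) (p : Euc N × ℝ) :
    grE (fun q => φ q + ψ q) p = grE φ p + grE ψ p := by
  unfold grE gradient
  rw [fderiv_fun_add (slice_xd h p) (slice_xd h' p), map_add]

lemma lpE_add (h : ContDiff ℝ 2 φ) (h' : ContDiff ℝ 2 ψ) (p : Euc N × ℝ) :
    lpE (fun q => φ q + ψ q) p = lpE φ p + lpE ψ p := by
  unfold lpE
  simp only [lapl_eq_laplacian]
  exact (slice_x h p.2).contDiffAt.laplacian_add (slice_x h' p.2).contDiffAt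

lemma dtE_tmul (θ : ℝ → ℝ) (hθ : Differentiable ℝ θ) (h : ContDiff ℝ 2 φ) (p : Euc N × ℝ) :
    dtE (fun q => θ q.2 * φ q) p = deriv θ p.2 * φ p + θ p.2 * dtE φ p :=
  deriv_fun_mul (hθ p.2) (slice_td h p)

lemma grE_tmul (θ : ℝ → ℝ) (h : ContDiff ℝ 2 φ) (p : Euc N × ℝ) :
    grE (fun q => θ q.2 * φ q) p = θ p.2 • grE φ p := by
  unfold grE gradient
  exact (congrArg _ (fderiv_const_mul (slice_xd h p) (θ p.2))).trans (map_smul _ _ _)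

lemma lpE_tmul (θ : ℝ → ℝ) (h : ContDiff ℝ 2 φ) (p : Euc N × ℝ) :
    lpE (fun q => θ q.2 * φ q) p = θ p.2 * lpE φ p := by
  unfold lpE
  simp only [lapl_eq_laplacian]
  exact InnerProductSpace.laplacian_smul (θ p.2) (slice_x h p.2).contDiffAt

lemma dtE_cmul (c : ℝ) (h : ContDiff ℝ 2 φ) (p : Euc N × ℝ) :
    dtE (fun q => c * φ q) p = c * dtE φ p := by
  simpa using dtE_tmul (fun _ => c) (by fun_prop) h p

lemma grE_cmul (c : ℝ) (h : ContDiff ℝ 2 φ) (p : Euc N × ℝ) :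
    grE (fun q => c * φ q) p = c • grE φ p := grE_tmul (fun _ => c) h p

lemma lpE_cmul (c : ℝ) (h : ContDiff ℝ 2 φ) (p : Euc N × ℝ) :
    lpE (fun q => c * φ q) p = c * lpE φ p := lpE_tmul (fun _ => c) h p

lemma dtE_const (c : ℝ) (p : Euc N × ℝ) : dtE (fun _ => c) p = 0 := by simp [dtE]
lemma grE_const (c : ℝ) (p : Euc N × ℝ) : grE (fun _ => c) p = 0 := by simp [grE, gradient]
lemma lpE_const (c : ℝ) (p : Euc N × ℝ) : lpE (fun _ => c) p = 0 := by
  have := lpE_cmul (φ := fun _ : Euc N × ℝ => c) 0 contDiff_const p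
  have h2 := lpE_cmul (φ := fun _ : Euc N × ℝ => (0:ℝ)) 0 contDiff_const p
  unfold lpE lapl
  refine Finset.sum_eq_zero fun i _ => ?_
  simp [iteratedFDeriv_const_of_ne]

lemma dtE_shift (a p : Euc N × ℝ) : dtE (fun q => φ (q + a)) p = dtE φ (p + a) := by
  unfold dtE
  exact deriv_comp_add_const (f := fun s => φ (p.1 + a.1, s)) a.2 p.2

lemma grE_shift (a p : Euc N × ℝ) : grE (fun q => φ (q + a)) p = grE φ (p + a) := by
  unfold grE gradient
  congr 1
  exact fderiv_comp_add_right (f := fun y => φ (y, p.2 + a.2)) a.1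

lemma lpE_shift (a p : Euc N × ℝ) : lpE (fun q => φ (q + a)) p = lpE φ (p + a) := by
  unfold lpE lapl
  refine Finset.sum_congr rfl fun i _ => ?_
  have := iteratedFDeriv_comp_add_right (𝕜 := ℝ) (f := fun y => φ (y, p.2 + a.2)) 2 a.1 p.1
  exact congrArg (fun T : Euc N [×2]→L[ℝ] ℝ => T ![EuclideanSpace.single i 1, EuclideanSpace.single i 1]) this

end lin

/-- computing a Laplacian from derivatives -/
lemma lapl_of {N : ℕ} {φ : Euc N → ℝ} (A : Euc N → Euc N) (hA : ∀ y, HasGradientAt φ (A y) y)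
    (x : Euc N) (B : Fin N → (Euc N →L[ℝ] ℝ)) (hφ : ContDiff ℝ 2 φ)
    (hB : ∀ i, HasFDerivAt (fun y => A y i) (B i) x) :
    lapl φ x = ∑ i, B i (EuclideanSpace.single i 1) := by
  unfold lapl
  refine Finset.sum_congr rfl fun i _ => ?_
  rw [iteratedFDeriv_two_apply]
  simp only [Matrix.cons_val_zero, Matrix.cons_val_one]
  have h1 : (fun y => fderiv ℝ φ y (EuclideanSpace.single i 1)) = fun y => A y i := by
    ext y
    rw [(hA y).hasFDerivAt.fderiv]
    simp [InnerProductSpace.toDual_apply_apply, EuclideanSpace.inner_single_right]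
  have hd : DifferentiableAt ℝ (fderiv ℝ φ) x :=
    ((hφ.fderiv_right (m := 1) (by norm_num)).differentiable (by norm_num)).differentiableAt
  have h2 := hd.hasFDerivAt.clm_apply (hasFDerivAt_const (EuclideanSpace.single i (1:ℝ)) x)
  rw [h1] at h2
  rw [(hB i).unique h2]
  simp
end

open Set Filter Topology Metric MeasureTheory

noncomputable section

section cont
variable {N : ℕ} {φ : Euc N × ℝ → ℝ}

lemma hasF_x (h : ContDiff ℝ 2 φ) (x : Euc N) (t : ℝ) :
    HasFDerivAt (fun y => φ (y, t)) ((fderiv ℝ φ (x, t)).comp (ContinuousLinearMap.inl ℝ (Euc N) ℝ)) x := by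
  have h1 : HasFDerivAt φ (fderiv ℝ φ (x, t)) (x, t) :=
    (h.differentiable (by norm_num)).differentiableAt.hasFDerivAt
  exact h1.comp x (hasFDerivAt_prodMk_left x t)

lemma hasF_t (h : ContDiff ℝ 2 φ) (x : Euc N) (t : ℝ) :
    HasDerivAt (fun s => φ (x, s)) (fderiv ℝ φ (x, t) (0, 1)) t := by
  have h1 : HasFDerivAt φ (fderiv ℝ φ (x, t)) (x, t) :=
    (h.differentiable (by norm_num)).differentiableAt.hasFDerivAt
  have h2 := h1.comp t (hasFDerivAt_prodMk_right x t)
  have h3 : (fderiv ℝ φ (x, t)).comp (ContinuousLinearMap.inr ℝ (Euc N) ℝ) 1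
      = fderiv ℝ φ (x, t) (0, 1) := by simp
  rw [← h3]
  exact h2.hasDerivAt

lemma dtE_eq (h : ContDiff ℝ 2 φ) (p : Euc N × ℝ) : dtE φ p = fderiv ℝ φ p (0, 1) :=
  (hasF_t h p.1 p.2).deriv

lemma grE_eq (h : ContDiff ℝ 2 φ) (p : Euc N × ℝ) : grE φ p =
    (InnerProductSpace.toDual ℝ (Euc N)).symm
      ((fderiv ℝ φ p).comp (ContinuousLinearMap.inl ℝ (Euc N) ℝ)) := by
  unfold grE gradient
  rw [(hasF_x h p.1 p.2).fderiv]

lemma lpE_eq (h : ContDiff ℝ 2 φ) (p : Euc N × ℝ) : lpE φ p =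
    ∑ i : Fin N, fderiv ℝ (fderiv ℝ φ) p (EuclideanSpace.single i 1, 0)
      (EuclideanSpace.single i 1, 0) := by
  unfold lpE lapl
  refine Finset.sum_congr rfl fun i _ => ?_
  rw [iteratedFDeriv_two_apply]
  simp only [Matrix.cons_val_zero, Matrix.cons_val_one]
  have h1 : fderiv ℝ (fun y => φ (y, p.2)) =
      fun y => (fderiv ℝ φ (y, p.2)).comp (ContinuousLinearMap.inl ℝ (Euc N) ℝ) :=
    funext fun y => (hasF_x h y p.2).fderiv
  rw [h1]
  have hd : HasFDerivAt (fderiv ℝ φ) (fderiv ℝ (fderiv ℝ φ) p) (p.1, p.2) :=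
    ((h.fderiv_right (m := 1) (by norm_num)).differentiable
      (by norm_num)).differentiableAt.hasFDerivAt
  have h0 : HasFDerivAt (fun y : Euc N => (y, p.2)) (ContinuousLinearMap.inl ℝ (Euc N) ℝ) p.1 :=
    hasFDerivAt_prodMk_left p.1 p.2
  have h2 := HasFDerivAt.comp (f := fun y : Euc N => (y, p.2)) (g := fderiv ℝ φ) p.1 hd h0
  have h3 := h2.clm_comp (hasFDerivAt_const (ContinuousLinearMap.inl ℝ (Euc N) ℝ) p.1)
  have h4 := h3.fderiv
  simp only [Function.comp_def] at h4
  rw [h4]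
  simp

lemma dtE_cont (h : ContDiff ℝ 2 φ) : Continuous (dtE φ) := by
  rw [funext (dtE_eq h)]
  have := h.continuous_fderiv (by norm_num)
  fun_prop

lemma grE_cont (h : ContDiff ℝ 2 φ) : Continuous (grE φ) := by
  rw [funext (grE_eq h)]
  have := h.continuous_fderiv (by norm_num)
  fun_prop

lemma lpE_cont (h : ContDiff ℝ 2 φ) : Continuous (lpE φ) := by
  rw [funext (lpE_eq h)]
  have := (h.fderiv_right (m := 1) (by norm_num)).continuous_fderiv (by norm_num)
  fun_prop

lemma second_deriv_nonpos {k : ℝ → ℝ} (hk : Continuous k) (hm : IsLocalMax k 0) :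
    deriv (deriv k) 0 ≤ 0 := by
  by_contra hc
  push Not at hc
  have h1 := isLocalMin_of_deriv_deriv_pos hc hm.deriv_eq_zero hk.continuousAt
  have h2 : k =ᶠ[𝓝 0] fun _ => k 0 := by
    filter_upwards [h1, hm] with x a b using le_antisymm b a
  have h3 : deriv (deriv k) 0 = 0 := by
    rw [(h2.deriv).deriv_eq]; simp
  linarith

lemma dtE_max (hm : IsLocalMax φ p) : dtE φ p = 0 := by
  apply IsLocalMax.deriv_eq_zero
  exact hm.comp_continuous (g := fun s => (p.1, s)) (b := p.2) (by fun_prop)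

lemma grE_max (hm : IsLocalMax φ p) : grE φ p = 0 := by
  have : IsLocalMax (fun y => φ (y, p.2)) p.1 :=
    hm.comp_continuous (g := fun y => (y, p.2)) (b := p.1) (by fun_prop)
  unfold grE gradient
  rw [this.fderiv_eq_zero, map_zero]

lemma lpE_max (h : ContDiff ℝ 2 φ) {p : Euc N × ℝ} (hm : IsLocalMax φ p) : lpE φ p ≤ 0 := by
  rw [lpE_eq h]
  refine Finset.sum_nonpos fun i _ => ?_
  set e : Euc N × ℝ := (EuclideanSpace.single i 1, 0)
  have hl : ∀ s : ℝ, HasDerivAt (fun s : ℝ => p + s • e) e s := fun s => by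
    simpa using ((hasDerivAt_id s).smul_const e).const_add p
  have h1 : deriv (fun s : ℝ => φ (p + s • e)) = fun s => fderiv ℝ φ (p + s • e) e := by
    ext s
    exact (((h.differentiable (by norm_num)).differentiableAt.hasFDerivAt).comp_hasDerivAt s
      (hl s)).deriv
  have h2 : deriv (deriv (fun s : ℝ => φ (p + s • e))) 0 = fderiv ℝ (fderiv ℝ φ) p e e := by
    rw [h1]
    have hd : HasFDerivAt (fderiv ℝ φ) (fderiv ℝ (fderiv ℝ φ) p) (p + (0:ℝ) • e) := by
      simpa using ((h.fderiv_right (m := 1) (by norm_num)).differentiable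
        (by norm_num)).differentiableAt.hasFDerivAt
    have h3 := hd.comp_hasDerivAt (0:ℝ) (hl 0)
    have h4 := h3.clm_apply (hasDerivAt_const (0:ℝ) e)
    simpa using h4.deriv
  rw [← h2]
  apply second_deriv_nonpos
  · have := h.continuous
    fun_prop
  · have hm' : IsLocalMax φ (p + (0:ℝ) • e) := by simpa using hm
    exact hm'.comp_continuous (g := fun s : ℝ => p + s • e) (b := 0) (by fun_prop)

end cont

/-- squared distance -/
def qd {N : ℕ} (a q : Euc N × ℝ) : ℝ := ‖q.1 - a.1‖ ^ 2 + (q.2 - a.2) ^ 2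

lemma qd_contDiff {N : ℕ} (a : Euc N × ℝ) : ContDiff ℝ 2 (qd a) := by
  unfold qd
  exact ((contDiff_fst.sub contDiff_const).norm_sq ℝ).add ((contDiff_snd.sub contDiff_const).pow 2)

lemma dtE_qd {N : ℕ} (a p : Euc N × ℝ) : dtE (qd a) p = 2 * (p.2 - a.2) := by
  have h := (((hasDerivAt_id p.2).sub_const a.2).pow 2).const_add (‖p.1 - a.1‖ ^ 2)
  simpa [dtE, qd] using h.deriv

lemma hasGrad_sq {N : ℕ} (a y : Euc N) :
    HasGradientAt (fun z : Euc N => ‖z - a‖ ^ 2) ((2:ℝ) • (y - a)) y := by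
  have h := ((hasFDerivAt_id y).sub_const a).norm_sq
  rw [hasGradientAt_iff_hasFDerivAt]
  refine HasFDerivAt.congr_fderiv (f := fun z : Euc N => ‖z - a‖ ^ 2) h ?_
  ext v
  simp [InnerProductSpace.toDual_apply_apply, inner_smul_left, inner_sub_left]

lemma grE_qd {N : ℕ} (a p : Euc N × ℝ) : grE (qd a) p = (2:ℝ) • (p.1 - a.1) := by
  apply HasGradientAt.gradient
  have h := hasGrad_sq a.1 p.1
  rw [hasGradientAt_iff_hasFDerivAt] at h ⊢
  exact h.add_const ((p.2 - a.2) ^ 2)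

lemma lpE_qd {N : ℕ} (a p : Euc N × ℝ) : lpE (qd a) p = 2 * N := by
  unfold lpE
  rw [lapl_of (fun y => (2:ℝ) • (y - a.1)) (fun y => by
    have h := hasGrad_sq a.1 y
    rw [hasGradientAt_iff_hasFDerivAt] at h ⊢
    exact h.add_const ((p.2 - a.2) ^ 2)) p.1 (fun i => (2:ℝ) • (EuclideanSpace.proj i : Euc N →L[ℝ] ℝ))
    (slice_x (qd_contDiff a) p.2)]
  · simp [mul_comm]
  · intro i
    have h := (((EuclideanSpace.proj i : Euc N →L[ℝ] ℝ).hasFDerivAt (x := p.1)).sub_const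
      (a.1 i)).const_smul (2:ℝ)
    exact h

/-- plane waves -/
def wv {N : ℕ} (c : ℂ) (ξ : Euc N) (ω : ℝ) (q : Euc N × ℝ) : ℝ :=
  c.re * Real.cos (inner ℝ ξ q.1 + ω * q.2) - c.im * Real.sin (inner ℝ ξ q.1 + ω * q.2)

lemma wv_contDiff {N : ℕ} (c : ℂ) (ξ : Euc N) (ω : ℝ) : ContDiff ℝ 2 (wv c ξ ω) := by
  have h : ContDiff ℝ 2 (fun q : Euc N × ℝ => inner ℝ ξ q.1 + ω * q.2) :=
    (contDiff_const.inner ℝ contDiff_fst).add (contDiff_const.mul contDiff_snd)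
  exact (contDiff_const.mul h.cos).sub (contDiff_const.mul h.sin)

lemma dtE_wv {N : ℕ} (c : ℂ) (ξ : Euc N) (ω : ℝ) (p : Euc N × ℝ) :
    dtE (wv c ξ ω) p = wv (Complex.I * ω * c) ξ ω p := by
  have h0 : HasDerivAt (fun s : ℝ => inner ℝ ξ p.1 + ω * s) ω p.2 := by
    simpa using ((hasDerivAt_id p.2).const_mul ω).const_add (inner ℝ ξ p.1)
  have h := (h0.cos.const_mul c.re).sub (h0.sin.const_mul c.im)
  have h2 := h.deriv
  unfold dtE
  refine Eq.trans h2 ?_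
  simp [wv]
  ring

lemma hasGrad_wv {N : ℕ} (c : ℂ) (ξ : Euc N) (ω : ℝ) (y : Euc N) (t : ℝ) :
    HasGradientAt (fun z => wv c ξ ω (z, t)) (wv (Complex.I * c) ξ ω (y, t) • ξ) y := by
  have h0 : HasFDerivAt (fun z : Euc N => inner ℝ ξ z + ω * t) (innerSL ℝ ξ) y :=
    ((innerSL ℝ ξ).hasFDerivAt (x := y)).add_const (ω * t)
  have h := (h0.cos.const_mul c.re).sub (h0.sin.const_mul c.im)
  rw [hasGradientAt_iff_hasFDerivAt]
  refine HasFDerivAt.congr_fderiv (f := fun z => wv c ξ ω (z, t)) h ?_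
  ext v
  simp [wv, inner_smul_left, InnerProductSpace.toDual_apply_apply]
  ring

lemma grE_wv {N : ℕ} (c : ℂ) (ξ : Euc N) (ω : ℝ) (p : Euc N × ℝ) :
    grE (wv c ξ ω) p = wv (Complex.I * c) ξ ω p • ξ :=
  (hasGrad_wv c ξ ω p.1 p.2).gradient

lemma lpE_wv {N : ℕ} (c : ℂ) (ξ : Euc N) (ω : ℝ) (p : Euc N × ℝ) :
    lpE (wv c ξ ω) p = - ‖ξ‖ ^ 2 * wv c ξ ω p := by
  unfold lpE
  rw [lapl_of (fun y => wv (Complex.I * c) ξ ω (y, p.2) • ξ) (fun y => hasGrad_wv c ξ ω y p.2) p.1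
    (fun i => (ξ i * wv (Complex.I * (Complex.I * c)) ξ ω p) • innerSL ℝ ξ)
    (slice_x (wv_contDiff _ _ _) p.2)]
  · rw [EuclideanSpace.norm_sq_eq]
    simp only [← mul_assoc, Complex.I_mul_I]
    simp [EuclideanSpace.inner_single_right, wv, Finset.sum_mul]
    rw [← Finset.sum_neg_distrib]
    refine Finset.sum_congr rfl fun i _ => by ring
  · intro i
    have h := (hasGrad_wv (Complex.I * c) ξ ω p.1 p.2).hasFDerivAt.mul_const (ξ i)
    refine HasFDerivAt.congr_fderiv h ?_
    ext v
    simp [inner_smul_left, InnerProductSpace.toDual_apply_apply]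
    ring
end

open Set Filter Topology Metric MeasureTheory

noncomputable section

/-- linear parabolic operator -/
def Lop {N : ℕ} (b : Euc N) (φ : Euc N × ℝ → ℝ) (p : Euc N × ℝ) : ℝ :=
  dtE φ p - lpE φ p + inner ℝ b (grE φ p)

section Lop
variable {N : ℕ} {b : Euc N} {φ ψ : Euc N × ℝ → ℝ}

lemma Lop_add (h : ContDiff ℝ 2 φ) (h' : ContDiff ℝ 2 ψ) (p : Euc N × ℝ) :
    Lop b (fun q => φ q + ψ q) p = Lop b φ p + Lop b ψ p := by
  unfold Lop
  rw [dtE_add h h', lpE_add h h', grE_add h h', inner_add_right]; ring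

lemma Lop_cmul (c : ℝ) (h : ContDiff ℝ 2 φ) (p : Euc N × ℝ) :
    Lop b (fun q => c * φ q) p = c * Lop b φ p := by
  unfold Lop
  rw [dtE_cmul c h, lpE_cmul c h, grE_cmul c h, inner_smul_right]; ring

lemma Lop_const (c : ℝ) (p : Euc N × ℝ) : Lop b (fun _ => c) p = 0 := by
  unfold Lop
  simp [dtE_const, lpE_const, grE_const]

lemma Lop_sub (h : ContDiff ℝ 2 φ) (h' : ContDiff ℝ 2 ψ) (p : Euc N × ℝ) :
    Lop b (fun q => φ q - ψ q) p = Lop b φ p - Lop b ψ p := by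
  have h1 : (fun q => φ q - ψ q) = fun q => φ q + (fun q => (-1) * ψ q) q := by ext; simp; ring
  rw [h1, Lop_add h (contDiff_const.mul h'), Lop_cmul _ h']; ring

lemma Lop_cont (h : ContDiff ℝ 2 φ) : Continuous (Lop b φ) := by
  have := dtE_cont h
  have := lpE_cont h
  have := grE_cont h
  unfold Lop
  fun_prop

lemma Lop_max (h : ContDiff ℝ 2 φ) {p : Euc N × ℝ} (hm : IsLocalMax φ p) : 0 ≤ Lop b φ p := by
  unfold Lop
  rw [dtE_max hm, grE_max hm, inner_zero_right]
  linarith [lpE_max h hm]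

lemma Lop_sum {ι : Type*} (s : Finset ι) (F : ι → Euc N × ℝ → ℝ) (h : ∀ i, ContDiff ℝ 2 (F i))
    (p : Euc N × ℝ) : Lop b (fun q => ∑ i ∈ s, F i q) p = ∑ i ∈ s, Lop b (F i) p := by
  classical
  induction s using Finset.induction_on with
  | empty => simpa using Lop_const 0 p
  | insert a s ha ih =>
    rw [Finset.sum_insert ha, ← ih]
    simp only [Finset.sum_insert ha]
    exact Lop_add (h a) (ContDiff.sum fun i _ => h i) p

lemma Lop_wv (c : ℂ) (ξ : Euc N) (ω : ℝ) (p : Euc N × ℝ) :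
    Lop b (wv c ξ ω) p = wv ((((‖ξ‖ ^ 2 : ℝ) : ℂ) + ((ω + inner ℝ b ξ : ℝ) : ℂ) * Complex.I) * c) ξ ω p := by
  unfold Lop
  rw [dtE_wv, lpE_wv, grE_wv, inner_smul_right]
  simp only [wv, Complex.mul_re, Complex.mul_im, Complex.add_re, Complex.add_im,
    Complex.ofReal_re, Complex.ofReal_im, Complex.I_re, Complex.I_im]
  ring

lemma Lop_qd (a p : Euc N × ℝ) : Lop b (qd a) p =
    2 * (p.2 - a.2) - 2 * N + 2 * inner ℝ b (p.1 - a.1) := by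
  unfold Lop
  rw [dtE_qd, lpE_qd, grE_qd, inner_smul_right]

end Lop

lemma qd_ge {N : ℕ} {a q : Euc N × ℝ} : dist q a ^ 2 ≤ qd a q := by
  rw [Prod.dist_eq, qd, ← dist_eq_norm, ← sq_abs (q.2 - a.2), ← Real.dist_eq]
  rcases max_choice (dist q.1 a.1) (dist q.2 a.2) with h | h <;> rw [h]
  all_goals nlinarith [sq_nonneg (dist q.1 a.1), sq_nonneg (dist q.2 a.2)]

lemma qd_nonneg {N : ℕ} (a q : Euc N × ℝ) : 0 ≤ qd a q := by unfold qd; positivity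
lemma qd_self {N : ℕ} (a : Euc N × ℝ) : qd a a = 0 := by simp [qd]

/-- constant in the barrier lemma -/
def kap {N : ℕ} (b : Euc N) : ℝ := 2 * N + 1 + ‖b‖ ^ 2

lemma kap_pos {N : ℕ} (b : Euc N) : 0 < kap b := by unfold kap; positivity

lemma barrier {N : ℕ} (b : Euc N) {lam R M : ℝ} (hl : 1 ≤ lam) (hR : 0 < R) (hM : 0 ≤ M)
    (p : Euc N × ℝ) (z : Euc N × ℝ → ℝ) (hz : ContinuousOn z (closedBall p R))
    (hzM : ∀ q ∈ closedBall p R, z q ≤ M)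
    (H : ∀ q ∈ ball p R, IsLocalMax (fun q => z q - M / R ^ 2 * qd p q) q →
      M / R ^ 2 * Lop b (qd p) q + lam * z q ≤ 0) :
    z p ≤ M * (kap b / (R ^ 2 * lam)) := by
  by_contra hc
  push Not at hc
  have hA : 0 ≤ M / R ^ 2 := by positivity
  set A := M / R ^ 2 with hAd
  have hMA : A * R ^ 2 = M := by rw [hAd]; field_simp
  have hk := kap_pos b
  have hkl : M * (kap b / (R ^ 2 * lam)) = A * (kap b / lam) := by rw [hAd]; field_simp
  rw [hkl] at hc
  obtain ⟨q, hq, hmax⟩ := (isCompact_closedBall p R).exists_isMaxOn ⟨p, mem_closedBall_self hR.le⟩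
    (hz.sub ((qd_contDiff p).continuous.const_smul A).continuousOn)
  have hqp : A * (kap b / lam) < z q - A * qd p q := by
    have := hmax (mem_closedBall_self hR.le)
    simp [qd_self] at this
    linarith
  have hpos : 0 ≤ A * (kap b / lam) := by positivity
  have hqb : q ∈ ball p R := by
    by_contra hn
    rw [mem_ball, not_lt] at hn
    have h1 : R ^ 2 ≤ qd p q := (by gcongr : R ^ 2 ≤ dist q p ^ 2).trans qd_ge
    nlinarith [hzM q hq, mul_le_mul_of_nonneg_left h1 hA]
  have hloc : IsLocalMax (fun q => z q - A * qd p q) q := by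
    filter_upwards [isOpen_ball.mem_nhds hqb] with y hy
    simpa using hmax (ball_subset_closedBall hy)
  have h2 := H q hqb hloc
  have h3 : -(kap b) - qd p q ≤ Lop b (qd p) q := by
    rw [Lop_qd, kap, qd]
    have h4 : -(‖b‖ * ‖q.1 - p.1‖) ≤ inner ℝ b (q.1 - p.1) :=
      neg_le_of_abs_le (abs_real_inner_le_norm _ _)
    nlinarith [sq_nonneg (‖b‖ - ‖q.1 - p.1‖), sq_nonneg (q.2 - p.2 + 1)]
  have h4 := mul_le_mul_of_nonneg_left h3 hA
  have h5 : lam * (A * (kap b / lam) + A * qd p q) < lam * z q := by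
    apply mul_lt_mul_of_pos_left _ (by linarith); linarith
  have h6 : lam * (A * (kap b / lam) + A * qd p q) = A * kap b + lam * (A * qd p q) := by
    field_simp
  have h7 : 0 ≤ A * qd p q := mul_nonneg hA (qd_nonneg _ _)
  nlinarith

lemma barrier_smooth {N : ℕ} (b : Euc N) {lam R M : ℝ} (hl : 1 ≤ lam) (hR : 0 < R) (hM : 0 ≤ M)
    (p : Euc N × ℝ) (z : Euc N × ℝ → ℝ) (hz : ContDiff ℝ 2 z)
    (hzM : ∀ q ∈ closedBall p R, z q ≤ M)
    (H : ∀ q ∈ ball p R, Lop b z q + lam * z q ≤ 0) :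
    z p ≤ M * (kap b / (R ^ 2 * lam)) := by
  refine barrier b hl hR hM p z hz.continuous.continuousOn hzM fun q hq hloc => ?_
  have h1 := Lop_max (b := b) (hz.sub (contDiff_const.mul (qd_contDiff p))) hloc
  rw [Lop_sub hz (contDiff_const.mul (qd_contDiff p)), Lop_cmul _ (qd_contDiff p)] at h1
  linarith [H q hq]

lemma barrier_smooth2 {N : ℕ} (b : Euc N) {lam R M : ℝ} (hl : 1 ≤ lam) (hR : 0 < R) (hM : 0 ≤ M)
    (p : Euc N × ℝ) (z : Euc N × ℝ → ℝ) (hz : ContDiff ℝ 2 z)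
    (hzM : ∀ q ∈ closedBall p (2 * R), z q ≤ M)
    (H : ∀ q ∈ closedBall p (2 * R), Lop b z q + lam * z q ≤ 0) :
    z p ≤ M * (kap b / (R ^ 2 * lam)) * (kap b / (R ^ 2 * lam)) := by
  have hk := kap_pos b
  have sub : ∀ q ∈ closedBall p R, closedBall q R ⊆ closedBall p (2 * R) := fun q hq =>
    closedBall_subset_closedBall' (by rw [mem_closedBall] at hq; linarith)
  refine barrier_smooth b hl hR (by positivity) p z hz (fun q hq => ?_) (fun q hq => ?_)
  · exact barrier_smooth b hl hR hM q z hz (fun r hr => hzM r (sub q hq hr))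
      fun r hr => H r (sub q hq (ball_subset_closedBall hr))
  · exact H q (sub p (mem_closedBall_self hR.le) (ball_subset_closedBall hq))

/-- viscosity subsolution of the linear equation in an open set -/
def LSub {N : ℕ} (b : Euc N) (U : Set (Euc N × ℝ)) (h v : Euc N × ℝ → ℝ) : Prop :=
  ∀ φ : Euc N × ℝ → ℝ, ContDiff ℝ 2 φ → ∀ p ∈ U, IsLocalMax (fun q => v q - φ q) p →
    Lop b φ p ≤ h p

lemma barrier_visc {N : ℕ} (b : Euc N) {lam R M : ℝ} (hl : 1 ≤ lam) (hR : 0 < R) (hM : 0 ≤ M)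
    (p : Euc N × ℝ) (v w h : Euc N × ℝ → ℝ) (U : Set (Euc N × ℝ)) (hv : Continuous v)
    (hw : ContDiff ℝ 2 w) (hsub : LSub b U h v) (hU : closedBall p R ⊆ U)
    (hzM : ∀ q ∈ closedBall p R, v q - w q ≤ M)
    (H : ∀ q ∈ closedBall p R, lam * v q + h q ≤ Lop b w q + lam * w q) :
    v p - w p ≤ M * (kap b / (R ^ 2 * lam)) := by
  refine barrier b hl hR hM p (fun q => v q - w q) (hv.sub hw.continuous).continuousOn hzM
    fun q hq hloc => ?_
  have h1 := hsub (fun q => w q + M / R ^ 2 * qd p q) (hw.add (contDiff_const.mul (qd_contDiff p)))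
    q (hU (ball_subset_closedBall hq)) (by
      have : (fun q => v q - (w q + M / R ^ 2 * qd p q)) =
        (fun q => v q - w q - M / R ^ 2 * qd p q) := by ext; ring
      rw [this]; exact hloc)
  rw [Lop_add hw (contDiff_const.mul (qd_contDiff p)), Lop_cmul _ (qd_contDiff p)] at h1
  have := H q (ball_subset_closedBall hq)
  linarith

lemma barrier_visc2 {N : ℕ} (b : Euc N) {lam R M : ℝ} (hl : 1 ≤ lam) (hR : 0 < R) (hM : 0 ≤ M)
    (p : Euc N × ℝ) (v w h : Euc N × ℝ → ℝ) (U : Set (Euc N × ℝ)) (hv : Continuous v)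
    (hw : ContDiff ℝ 2 w) (hsub : LSub b U h v) (hU : closedBall p (2 * R) ⊆ U)
    (hzM : ∀ q ∈ closedBall p (2 * R), v q - w q ≤ M)
    (H : ∀ q ∈ closedBall p (2 * R), lam * v q + h q ≤ Lop b w q + lam * w q) :
    v p - w p ≤ M * (kap b / (R ^ 2 * lam)) * (kap b / (R ^ 2 * lam)) := by
  have hk := kap_pos b
  have sub : ∀ q ∈ closedBall p R, closedBall q R ⊆ closedBall p (2 * R) := fun q hq =>
    closedBall_subset_closedBall' (by rw [mem_closedBall] at hq; linarith)
  have sub0 := sub p (mem_closedBall_self hR.le)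
  refine barrier_visc b hl hR (by positivity) p v w h U hv hw hsub (sub0.trans hU)
    (fun q hq => ?_) (fun q hq => H q (sub0 hq))
  exact barrier_visc b hl hR hM q v w h U hv hw hsub ((sub q hq).trans hU)
    (fun r hr => hzM r (sub q hq hr)) fun r hr => H r (sub q hq hr)

end

open Set Filter Topology Metric MeasureTheory

noncomputable section

/-- finite sums of plane waves -/
def wvs {N : ℕ} {ι : Type} (s : Finset ι) (c : ι → ℂ) (ξ : ι → Euc N) (ω : ι → ℝ)
    (q : Euc N × ℝ) : ℝ := ∑ i ∈ s, wv (c i) (ξ i) (ω i) q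

/-- coordinates -/
def crd {N : ℕ} (q : Euc N × ℝ) : Option (Fin N) → ℝ
  | none => q.2
  | some i => q.1 i

/-- projection to the torus -/
def tor {N : ℕ} (q : Euc N × ℝ) : UnitAddTorus (Option (Fin N)) := fun j => (crd q j : UnitAddCircle)

lemma crd_cont {N : ℕ} (j : Option (Fin N)) : Continuous (fun q : Euc N × ℝ => crd q j) := by
  cases j with
  | none => exact continuous_snd
  | some i => exact (EuclideanSpace.proj i : Euc N →L[ℝ] ℝ).continuous.comp continuous_fst

lemma tor_cont {N : ℕ} : Continuous (tor (N := N)) :=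
  continuous_pi fun j => (AddCircle.continuous_mk' 1).comp (crd_cont j)

lemma crd_dist {N : ℕ} (p q : Euc N × ℝ) (j : Option (Fin N)) : |crd p j - crd q j| ≤ dist p q := by
  rw [Prod.dist_eq]
  cases j with
  | none => exact le_max_right _ _
  | some i =>
    refine le_trans ?_ (le_max_left _ _)
    rw [dist_eq_norm]
    exact PiLp.norm_apply_le (p.1 - q.1) i

lemma tor_inj {N : ℕ} (p0 : Euc N × ℝ) {r : ℝ} (hr : r < 1 / 2) : InjOn tor (closedBall p0 r) := by
  intro p hp q hq h
  have hd : dist p q < 1 := by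
    rw [mem_closedBall] at hp hq
    have := dist_triangle_right p q p0
    linarith
  have key : ∀ j, crd p j = crd q j := by
    intro j
    have h1 : ((crd p j - crd q j : ℝ) : UnitAddCircle) = 0 := by
      have := congrFun h j
      simp only [tor] at this
      rw [AddCircle.coe_sub, this, sub_self]
    replace h1 := (AddCircle.coe_eq_zero_iff 1).1 h1
    obtain ⟨n, hn⟩ := h1
    have h2 := (crd_dist p q j).trans_lt hd
    rw [← hn] at h2
    simp only [zsmul_eq_mul, mul_one] at h2 hn
    have h3 : n = 0 := by
      have : |n| < 1 := by exact_mod_cast h2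
      exact Int.abs_lt_one_iff.1 this
    rw [h3] at hn
    simp at hn
    linarith
  refine Prod.ext ?_ (key none)
  ext i
  exact key (some i)

/-- space frequency -/
def frx {N : ℕ} (n : Option (Fin N) → ℤ) : Euc N :=
  WithLp.toLp 2 (fun i => 2 * Real.pi * (n (some i) : ℝ))

/-- time frequency -/
def frt {N : ℕ} (n : Option (Fin N) → ℤ) : ℝ := 2 * Real.pi * (n none : ℝ)

lemma re_mFourier {N : ℕ} (n : Option (Fin N) → ℤ) (c : ℂ) (q : Euc N × ℝ) :
    (c * UnitAddTorus.mFourier n (tor q)).re = wv c (frx n) (frt n) q := by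
  have h1 : UnitAddTorus.mFourier n (tor q) =
      Complex.exp (((inner ℝ (frx n) q.1 + frt n * q.2 : ℝ) : ℂ) * Complex.I) := by
    simp only [UnitAddTorus.mFourier, ContinuousMap.coe_mk, tor]
    simp only [fourier_coe_apply]
    rw [← Complex.exp_sum, Fintype.sum_option]
    congr 1
    simp only [crd, frx, frt, PiLp.inner_apply]
    push_cast
    rw [add_mul, add_comm, Finset.sum_mul]
    simp
    congr 1
    · refine Finset.sum_congr rfl fun i _ => by ring
    · ring
  rw [h1, wv, Complex.mul_re, Complex.exp_ofReal_mul_I_re, Complex.exp_ofReal_mul_I_im]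

lemma trig_approx {N : ℕ} (p0 : Euc N × ℝ) {r : ℝ} (hr : r < 1 / 2) (G : Euc N × ℝ → ℝ)
    (hG : Continuous G) {S η : ℝ} (hS : 0 ≤ S) (hη : 0 < η) (hGS : ∀ q ∈ closedBall p0 r, |G q| ≤ S) :
    ∃ (s : Finset (Option (Fin N) → ℤ)) (c : (Option (Fin N) → ℤ) → ℂ),
      (∀ q ∈ closedBall p0 r, |wvs s c frx frt q - G q| ≤ η) ∧
      ∀ q, |wvs s c frx frt q| ≤ S + η := by
  have : CompactSpace (closedBall p0 r) := isCompact_iff_compactSpace.1 (isCompact_closedBall p0 r)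
  have hemb : IsClosedEmbedding (fun q : closedBall p0 r => tor (q : Euc N × ℝ)) :=
    (tor_cont.comp continuous_subtype_val).isClosedEmbedding (fun a b h =>
      Subtype.ext (tor_inj p0 hr a.2 b.2 h))
  set G0 : BoundedContinuousFunction (closedBall p0 r) ℝ :=
    BoundedContinuousFunction.mkOfCompact ⟨fun q => G q, hG.comp continuous_subtype_val⟩
  obtain ⟨G1, hn, he⟩ :=
    BoundedContinuousFunction.exists_extension_norm_eq_of_isClosedEmbedding G0 hemb
  have hG0 : ‖G0‖ ≤ S := (BoundedContinuousFunction.norm_le hS).2 fun q => hGS q q.2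
  let G2 : C(UnitAddTorus (Option (Fin N)), ℂ) := ⟨fun x => (G1 x : ℂ), by fun_prop⟩
  have h1 : G2 ∈ (Submodule.span ℂ (range (UnitAddTorus.mFourier (d := Option (Fin N))))).topologicalClosure := by
    rw [UnitAddTorus.span_mFourier_closure_eq_top]; trivial
  obtain ⟨P, hP, hd⟩ := Metric.mem_closure_iff.1 h1 η hη
  obtain ⟨c, rfl⟩ := Finsupp.mem_span_range_iff_exists_finsupp.1 hP
  have hw : ∀ q, wvs c.support c frx frt q =
      ((c.sum fun i a => a • UnitAddTorus.mFourier i : C(UnitAddTorus (Option (Fin N)), ℂ)) (tor q)).re := by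
    intro q
    simp only [wvs, Finsupp.sum, ContinuousMap.coe_sum, Finset.sum_apply, Complex.re_sum,
      ContinuousMap.coe_smul, Pi.smul_apply, smul_eq_mul, re_mFourier]
  have hclose : ∀ q, |wvs c.support c frx frt q - G1 (tor q)| ≤ η := by
    intro q
    rw [hw]
    have h2 := (ContinuousMap.dist_apply_le_dist (f := G2) (g := (c.sum fun i a => a • UnitAddTorus.mFourier i)) (tor q)).trans hd.le
    rw [dist_comm, dist_eq_norm] at h2
    refine le_trans ?_ h2
    have h3 := Complex.abs_re_le_norm ((c.sum fun i a => a • UnitAddTorus.mFourier i : C(UnitAddTorus (Option (Fin N)), ℂ)) (tor q) - G2 (tor q))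
    simpa [G2] using h3
  refine ⟨c.support, c, fun q hq => ?_, fun q => ?_⟩
  · have h4 : G1 (tor q) = G q := congrFun he ⟨q, hq⟩
    rw [← h4]; exact hclose q
  · have h5 : |G1 (tor q)| ≤ S := by
      have := G1.norm_coe_le_norm (tor q)
      rw [Real.norm_eq_abs] at this
      linarith
    have h6 := hclose q
    rw [abs_le] at *
    constructor <;> linarith [h5.1, h5.2, h6.1, h6.2]

end

open Set Filter Topology Metric MeasureTheory

noncomputable section

section moll
variable {N : ℕ} (ρ : ContDiffBump (0 : Euc N × ℝ))

/-- mollification -/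
def moll (v : Euc N × ℝ → ℝ) (x : Euc N × ℝ) : ℝ := ∫ y, ρ.normed volume y * v (x - y)

lemma moll_int {v : Euc N × ℝ → ℝ} (hv : Continuous v) :
    Integrable (fun y => ρ.normed volume y * v y) := by
  apply Continuous.integrable_of_hasCompactSupport
  · exact (ρ.continuous_normed).mul hv
  · exact ρ.hasCompactSupport_normed.mul_right

lemma moll_int' {v : Euc N × ℝ → ℝ} (hv : Continuous v) (x : Euc N × ℝ) :
    Integrable (fun y => ρ.normed volume y * v (x - y)) :=
  moll_int ρ (v := fun y => v (x - y)) (by fun_prop)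

lemma moll_contDiff {v : Euc N × ℝ → ℝ} (hv : Continuous v) : ContDiff ℝ 2 (moll ρ v) := by
  have : (volume : Measure (Euc N × ℝ)).IsAddHaarMeasure := by
    rw [Measure.volume_eq_prod]; infer_instance
  have h := ρ.hasCompactSupport_normed.contDiff_convolution_left (n := 2) (μ := volume)
    (ContinuousLinearMap.lsmul ℝ ℝ) (ρ.contDiff_normed (μ := volume)) (hv.locallyIntegrable (μ := volume))
  exact h

lemma moll_le {v w : Euc N × ℝ → ℝ} (hv : Continuous v) (hw : Continuous w) (x : Euc N × ℝ)
    (h : ∀ y ∈ closedBall x ρ.rOut, v y ≤ w y) : moll ρ v x ≤ moll ρ w x := by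
  refine integral_mono (moll_int' ρ hv x) (moll_int' ρ hw x) fun y => ?_
  by_cases hy : y ∈ Function.support (ρ.normed (volume : Measure (Euc N × ℝ)))
  · rw [ρ.support_normed_eq] at hy
    refine mul_le_mul_of_nonneg_left (h _ ?_) (ρ.nonneg_normed y)
    rw [mem_closedBall, dist_eq_norm]
    rw [mem_ball, dist_zero_right] at hy
    simpa using hy.le
  · rw [Function.notMem_support] at hy
    simp [hy]

lemma moll_const (c : ℝ) (x : Euc N × ℝ) : moll ρ (fun _ => c) x = c := by
  unfold moll
  rw [integral_mul_const, ρ.integral_normed, one_mul]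

lemma moll_add {v w : Euc N × ℝ → ℝ} (hv : Continuous v) (hw : Continuous w) (x : Euc N × ℝ) :
    moll ρ (fun q => v q + w q) x = moll ρ v x + moll ρ w x := by
  unfold moll
  rw [← integral_add (moll_int' ρ hv x) (moll_int' ρ hw x)]
  congr 1; ext y; ring

lemma moll_cmul (c : ℝ) (v : Euc N × ℝ → ℝ) (x : Euc N × ℝ) :
    moll ρ (fun q => c * v q) x = c * moll ρ v x := by
  unfold moll
  rw [← integral_const_mul]
  congr 1; ext y; ring

lemma moll_sum {ι : Type*} (s : Finset ι) (F : ι → Euc N × ℝ → ℝ) (h : ∀ i, Continuous (F i))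
    (x : Euc N × ℝ) : moll ρ (fun q => ∑ i ∈ s, F i q) x = ∑ i ∈ s, moll ρ (F i) x := by
  unfold moll
  rw [← integral_finsetSum s (fun i _ => moll_int' ρ (h i) x)]
  congr 1; ext y; rw [Finset.mul_sum]

lemma moll_close {v : Euc N × ℝ → ℝ} (hv : Continuous v) (x : Euc N × ℝ) {τ a : ℝ}
    (h : ∀ y ∈ closedBall x ρ.rOut, |v y - a| ≤ τ) : |moll ρ v x - a| ≤ τ := by
  rw [abs_le]
  have h1 := moll_le ρ hv continuous_const x (w := fun _ => a + τ) fun y hy => by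
    linarith [(abs_le.1 (h y hy)).2]
  have h2 := moll_le ρ continuous_const hv x (v := fun _ => a - τ) fun y hy => by
    linarith [(abs_le.1 (h y hy)).1]
  rw [moll_const] at h1 h2
  constructor <;> linarith

/-- the Fourier multiplier of the mollifier -/
def mul_rho (ξ : Euc N) (ω : ℝ) : ℂ :=
  ((∫ y : Euc N × ℝ, ρ.normed volume y * Real.cos (inner ℝ ξ y.1 + ω * y.2) : ℝ) : ℂ) -
  ((∫ y : Euc N × ℝ, ρ.normed volume y * Real.sin (inner ℝ ξ y.1 + ω * y.2) : ℝ) : ℂ) * Complex.I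

lemma moll_wv (c : ℂ) (ξ : Euc N) (ω : ℝ) :
    moll ρ (wv c ξ ω) = wv (mul_rho ρ ξ ω * c) ξ ω := by
  ext x
  have h1 : ∀ y : Euc N × ℝ, ρ.normed volume y * wv c ξ ω (x - y) =
      ρ.normed volume y * Real.cos (inner ℝ ξ y.1 + ω * y.2) * wv c ξ ω x -
      ρ.normed volume y * Real.sin (inner ℝ ξ y.1 + ω * y.2) * wv (Complex.I * c) ξ ω x := by
    intro y
    have : inner ℝ ξ (x - y).1 + ω * (x - y).2 =
      (inner ℝ ξ x.1 + ω * x.2) - (inner ℝ ξ y.1 + ω * y.2) := by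
      simp [inner_sub_right]; ring
    simp only [wv, this, Real.cos_sub, Real.sin_sub, Complex.mul_re, Complex.mul_im,
      Complex.I_re, Complex.I_im]
    ring
  unfold moll
  simp only [h1]
  rw [integral_sub, integral_mul_const, integral_mul_const]
  · simp only [wv, mul_rho, Complex.mul_re, Complex.mul_im, Complex.sub_re, Complex.sub_im,
      Complex.I_re, Complex.I_im, Complex.ofReal_re, Complex.ofReal_im]
    ring
  · refine (moll_int ρ (v := fun y => Real.cos (inner ℝ ξ y.1 + ω * y.2)) ?_).mul_const _
    fun_prop
  · refine (moll_int ρ (v := fun y => Real.sin (inner ℝ ξ y.1 + ω * y.2)) ?_).mul_const _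
    fun_prop

end moll

section wvs
variable {N : ℕ} {ι : Type} (s : Finset ι) (c : ι → ℂ) (ξ : ι → Euc N) (ω : ι → ℝ)

lemma wvs_contDiff : ContDiff ℝ 2 (wvs s c ξ ω) := ContDiff.sum fun _ _ => wv_contDiff _ _ _

/-- symbol -/
def symb (b : Euc N) (ξ : Euc N) (ω : ℝ) : ℂ :=
  (((‖ξ‖ ^ 2 : ℝ) : ℂ) + ((ω + inner ℝ b ξ : ℝ) : ℂ) * Complex.I)

lemma Lop_wvs (b : Euc N) (p : Euc N × ℝ) :
    Lop b (wvs s c ξ ω) p = wvs s (fun i => symb b (ξ i) (ω i) * c i) ξ ω p := by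
  unfold wvs
  rw [Lop_sum s _ (fun i => wv_contDiff _ _ _)]
  simp only [Lop_wv, symb]

lemma moll_wvs (ρ : ContDiffBump (0 : Euc N × ℝ)) :
    moll ρ (wvs s c ξ ω) = wvs s (fun i => mul_rho ρ (ξ i) (ω i) * c i) ξ ω := by
  ext x
  unfold wvs
  rw [moll_sum ρ s _ (fun i => (wv_contDiff _ _ _).continuous)]
  simp only [moll_wv]

lemma wvs_resolvent (b : Euc N) {lam : ℝ} (hl : 0 < lam) (p : Euc N × ℝ) :
    Lop b (wvs s (fun i => (lam + symb b (ξ i) (ω i))⁻¹ * c i) ξ ω) p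
      + lam * wvs s (fun i => (lam + symb b (ξ i) (ω i))⁻¹ * c i) ξ ω p = wvs s c ξ ω p := by
  rw [Lop_wvs]
  unfold wvs
  rw [Finset.mul_sum, ← Finset.sum_add_distrib]
  refine Finset.sum_congr rfl fun i _ => ?_
  have hne : (lam + symb b (ξ i) (ω i) : ℂ) ≠ 0 := by
    intro h
    have := congrArg Complex.re h
    simp [symb] at this
    norm_cast at this
    nlinarith [sq_nonneg ‖ξ i‖]
  have h2 : c i = symb b (ξ i) (ω i) * ((lam + symb b (ξ i) (ω i))⁻¹ * c i)
      + lam * ((lam + symb b (ξ i) (ω i))⁻¹ * c i) := by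
    field_simp
    ring
  conv_rhs => rw [h2]
  simp only [wv, Complex.add_re, Complex.add_im, Complex.re_ofReal_mul, Complex.im_ofReal_mul]
  ring

lemma wvs_bdd : ∃ B, 0 ≤ B ∧ ∀ q, |wvs s c ξ ω q| ≤ B := by
  refine ⟨∑ i ∈ s, (|(c i).re| + |(c i).im|), by positivity, fun q => ?_⟩
  refine (Finset.abs_sum_le_sum_abs _ _).trans (Finset.sum_le_sum fun i _ => ?_)
  refine (abs_sub _ _).trans (add_le_add ?_ ?_)
  · rw [abs_mul]; exact mul_le_of_le_one_right (abs_nonneg _) (Real.abs_cos_le_one _)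
  · rw [abs_mul]; exact mul_le_of_le_one_right (abs_nonneg _) (Real.abs_sin_le_one _)

lemma moll_resolvent (ρ : ContDiffBump (0 : Euc N × ℝ)) (b : Euc N) {lam : ℝ} (hl : 0 < lam)
    (p : Euc N × ℝ) :
    Lop b (moll ρ (wvs s (fun i => (lam + symb b (ξ i) (ω i))⁻¹ * c i) ξ ω)) p
      + lam * moll ρ (wvs s (fun i => (lam + symb b (ξ i) (ω i))⁻¹ * c i) ξ ω) p
      = moll ρ (wvs s c ξ ω) p := by
  rw [moll_wvs, moll_wvs]
  refine Eq.trans ?_ (wvs_resolvent s _ ξ ω b hl p)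
  have : (fun i => mul_rho ρ (ξ i) (ω i) * ((lam + symb b (ξ i) (ω i))⁻¹ * c i)) =
    (fun i => (lam + symb b (ξ i) (ω i))⁻¹ * (mul_rho ρ (ξ i) (ω i) * c i)) := by
    ext i; ring
  rw [this]

end wvs

lemma res_upper {N : ℕ} (b : Euc N) {lam S : ℝ} (hl : 1 ≤ lam) (w : Euc N × ℝ → ℝ)
    (hw : ContDiff ℝ 2 w) {B : ℝ} (hB : 0 ≤ B) (hb : ∀ q, |w q| ≤ B) (hS : 0 ≤ S)
    (h : ∀ q, Lop b w q + lam * w q ≤ S) (p : Euc N × ℝ) : w p ≤ S / lam := by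
  have hk := kap_pos b
  have key : ∀ R : ℝ, 0 < R → w p - S / lam ≤ B * (kap b / (R ^ 2 * lam)) := by
    intro R hR
    refine barrier_smooth b hl hR hB p (fun q => w q - S / lam) (hw.sub contDiff_const)
      (fun q _ => ?_) (fun q _ => ?_)
    · have : 0 ≤ S / lam := by positivity
      linarith [(abs_le.1 (hb q)).2]
    · rw [Lop_sub hw contDiff_const, Lop_const]
      have := h q
      have : lam * (S / lam) = S := by field_simp
      nlinarith
  have hlim : Tendsto (fun R : ℝ => B * (kap b / (R ^ 2 * lam))) atTop (𝓝 0) := by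
    rw [← mul_zero B]
    refine Tendsto.const_mul _ (Tendsto.div_atTop tendsto_const_nhds ?_)
    exact (tendsto_pow_atTop (by norm_num)).atTop_mul_const (by linarith)
  have := ge_of_tendsto hlim (eventually_gt_atTop 0 |>.mono key)
  linarith

lemma res_bound {N : ℕ} (b : Euc N) {lam S : ℝ} (hl : 1 ≤ lam) (w : Euc N × ℝ → ℝ)
    (hw : ContDiff ℝ 2 w) {B : ℝ} (hB : 0 ≤ B) (hb : ∀ q, |w q| ≤ B) (hS : 0 ≤ S)
    (h : ∀ q, |Lop b w q + lam * w q| ≤ S) (p : Euc N × ℝ) : |w p| ≤ S / lam := by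
  have h1 := res_upper b hl w hw hB hb hS (fun q => (abs_le.1 (h q)).2) p
  have h2 := res_upper b hl (fun q => (-1) * w q) (contDiff_const.mul hw) hB
    (fun q => by simpa using hb q) hS (fun q => by
      rw [Lop_cmul _ hw]; linarith [(abs_le.1 (h q)).1]) p
  rw [abs_le]; constructor <;> linarith

end

open Set Filter Topology Metric MeasureTheory

noncomputable section

lemma LML {N : ℕ} (b : Euc N) {v h : Euc N × ℝ → ℝ} (hv : Continuous v) (hh : Continuous h)
    {U : Set (Euc N × ℝ)} (hU : IsOpen U) (hsub : LSub b U h v)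
    (ρ : ContDiffBump (0 : Euc N × ℝ)) (hρ : ρ.rOut ≤ 1 / 16) (p0 : Euc N × ℝ)
    (hp0 : closedBall p0 ρ.rOut ⊆ U) :
    Lop b (moll ρ v) p0 ≤ moll ρ h p0 := by
  by_contra hcon
  push Not at hcon
  have hk := kap_pos b
  have hr := ρ.rOut_pos
  set r := ρ.rOut with hrd
  obtain ⟨δ, hδ, hδU⟩ := (isCompact_closedBall p0 r).exists_cthickening_subset_open hU hp0
  rw [cthickening_closedBall hδ.le hr.le] at hδU
  have hvc := moll_contDiff ρ hv
  have hhc := moll_contDiff ρ hh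
  obtain ⟨η, hη, hη4⟩ : ∃ η > 0, moll ρ h p0 + 4 * η < Lop b (moll ρ v) p0 :=
    ⟨(Lop b (moll ρ v) p0 - moll ρ h p0) / 8, by linarith, by linarith⟩
  have hev : ∀ᶠ q in 𝓝 p0, moll ρ h q + 4 * η < Lop b (moll ρ v) q :=
    (hhc.continuous.add continuous_const).continuousAt.eventually_lt
      (Lop_cont hvc).continuousAt hη4
  obtain ⟨R0, hR0, hR0s⟩ := Metric.nhds_basis_closedBall.eventually_iff.1 hev
  obtain ⟨R, hR, hRδ, hRR0, hR16⟩ : ∃ R > 0, 4 * R ≤ δ ∧ 2 * R ≤ R0 ∧ 4 * R ≤ 1 / 16 := by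
    refine ⟨min (δ / 4) (min (R0 / 2) (1 / 64)), by positivity, ?_, ?_, ?_⟩
    · linarith [min_le_left (δ / 4) (min (R0 / 2) (1 / 64))]
    · linarith [min_le_right (δ / 4) (min (R0 / 2) (1 / 64)), min_le_left (R0 / 2) (1 / 64)]
    · linarith [min_le_right (δ / 4) (min (R0 / 2) (1 / 64)), min_le_right (R0 / 2) (1 / 64)]
  set K := closedBall p0 (r + 4 * R) with hK
  have hKU : K ⊆ U := (closedBall_subset_closedBall (by linarith)).trans hδU
  obtain ⟨M1, hM1⟩ := (isCompact_closedBall p0 (r + 4 * R)).exists_bound_of_continuousOn hv.continuousOn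
  obtain ⟨M2, hM2⟩ := (isCompact_closedBall p0 (r + 4 * R)).exists_bound_of_continuousOn hh.continuousOn
  obtain ⟨M, hM, hMv, hMh⟩ : ∃ M, 0 ≤ M ∧ (∀ q ∈ K, |v q| ≤ M) ∧ ∀ q ∈ K, |h q| ≤ M :=
    ⟨max 0 (max M1 M2), le_max_left _ _,
      fun q hq => (hM1 q hq).trans ((le_max_left _ _).trans (le_max_right _ _)),
      fun q hq => (hM2 q hq).trans ((le_max_right _ _).trans (le_max_right _ _))⟩
  set M' := 3 * M + 4 * η with hM'
  set lam := 1 + 2 * M' * (kap b / R ^ 2) ^ 2 / η with hlam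
  have hM'0 : 0 ≤ M' := by positivity
  have hl : 1 ≤ lam := by
    have : 0 ≤ 2 * M' * (kap b / R ^ 2) ^ 2 / η := by positivity
    linarith
  have hl0 : 0 < lam := by linarith
  obtain ⟨s, c, hF1, hF2⟩ := trig_approx p0 (r := r + 4 * R) (by linarith)
    (fun q => lam * v q + h q + 2 * η) (by fun_prop) (S := lam * M + M + 2 * η) (η := η)
    (by positivity) hη (fun q hq => by
      have h1 := abs_le.1 (hMv q hq)
      have h2 := abs_le.1 (hMh q hq)
      have h3 := mul_le_mul_of_nonneg_left h1.1 hl0.le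
      have h4 := mul_le_mul_of_nonneg_left h1.2 hl0.le
      rw [abs_le]; constructor <;> nlinarith)
  set F := wvs s c (frx (N := N)) frt with hFd
  set w := wvs s (fun i => (lam + symb b (frx i) (frt i))⁻¹ * c i) frx frt with hwd
  have hwc : ContDiff ℝ 2 w := wvs_contDiff _ _ _ _
  have hFc : ContDiff ℝ 2 F := wvs_contDiff _ _ _ _
  have hres : ∀ q, Lop b w q + lam * w q = F q := fun q => wvs_resolvent s c frx frt b hl0 q
  have hmres : ∀ q, Lop b (moll ρ w) q + lam * moll ρ w q = moll ρ F q :=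
    fun q => moll_resolvent s c frx frt ρ b hl0 q
  have hwb : ∀ q, |w q| ≤ 2 * M + 3 * η := by
    intro q
    obtain ⟨B, hB, hBb⟩ := wvs_bdd s (fun i => (lam + symb b (frx i) (frt i))⁻¹ * c i) (frx (N := N)) frt
    have h1 := res_bound b hl w hwc hB hBb (S := lam * M + M + 2 * η + η) (by positivity)
      (fun q => by rw [hres]; exact hF2 q) q
    refine h1.trans ?_
    rw [div_le_iff₀ hl0]
    nlinarith [mul_nonneg hM (sub_nonneg.2 hl), mul_nonneg hη.le (sub_nonneg.2 hl)]
  -- step 1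
  set C := M' * (kap b / (R ^ 2 * lam)) * (kap b / (R ^ 2 * lam)) with hC
  have step1 : ∀ q ∈ closedBall p0 (r + 2 * R), v q - w q ≤ C := by
    intro q hq
    have hqK : closedBall q (2 * R) ⊆ K := closedBall_subset_closedBall' (by
      rw [mem_closedBall] at hq; linarith)
    refine barrier_visc2 b hl hR hM'0 q v w h U hv hwc hsub (hqK.trans hKU) (fun x hx => ?_)
      (fun x hx => ?_)
    · have h1 := abs_le.1 (hMv x (hqK hx))
      have h2 := abs_le.1 (hwb x)
      rw [hM']; linarith [h1.2, h2.1]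
    · rw [hres]
      have := abs_le.1 (hF1 x (hqK hx))
      linarith [this.1]
  have hball : ∀ q ∈ closedBall p0 (2 * R), closedBall q r ⊆ closedBall p0 (r + 2 * R) := fun q hq =>
    closedBall_subset_closedBall' (by rw [mem_closedBall] at hq; linarith)
  have hball' : closedBall p0 (r + 2 * R) ⊆ K := closedBall_subset_closedBall (by linarith)
  have hp0m : p0 ∈ closedBall p0 (2 * R) := mem_closedBall_self (by linarith)
  have step2 : moll ρ v p0 ≤ moll ρ w p0 + C := by
    have h1 := moll_le ρ hv (hwc.continuous.add continuous_const) p0 (w := fun q => w q + C)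
      fun y hy => by linarith [step1 y (hball p0 hp0m hy)]
    rwa [moll_add ρ hwc.continuous continuous_const, moll_const] at h1
  have hmwb : ∀ q, |moll ρ w q| ≤ 2 * M + 3 * η := fun q => by
    have := moll_close ρ hwc.continuous q (a := 0) (τ := 2 * M + 3 * η) fun y _ => by
      simpa using hwb y
    simpa using this
  have hmwc := moll_contDiff ρ hwc.continuous
  have step3 := barrier_smooth2 b hl hR hM'0 p0
    (fun q => (fun _ => η / lam) q - (fun q => moll ρ v q - moll ρ w q) q)
    (contDiff_const.sub (hvc.sub hmwc)) (fun q hq => by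
      have h1 := moll_close ρ hv q (a := 0) (τ := M) fun y hy => by
        simpa using hMv y (hball' (hball q hq hy))
      have h2 := abs_le.1 (hmwb q)
      rw [sub_zero, abs_le] at h1
      have h3 : η / lam ≤ η := div_le_self hη.le hl
      simp only
      rw [hM']; linarith [h1.1, h2.2]) (fun q hq => by
      rw [Lop_sub contDiff_const (hvc.sub hmwc), Lop_const, Lop_sub hvc hmwc]
      have h1 := hR0s (closedBall_subset_closedBall hRR0 hq)
      have h2 := hmres q
      have h3 := moll_le ρ hFc.continuous (w := fun q => (fun q => lam * v q) q
        + (fun q => h q + (fun _ => 3 * η) q) q) (by fun_prop) q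
        fun y hy => by
          have := abs_le.1 (hF1 y (hball' (hball q hq hy)))
          simp only
          linarith [this.2]
      rw [moll_add ρ (by fun_prop) (by fun_prop), moll_add ρ hh continuous_const, moll_const,
        moll_cmul] at h3
      have h4 : lam * (η / lam) = η := by field_simp
      simp only
      nlinarith)
  simp only at step3
  have h5 : η / lam ≤ 2 * C := by linarith
  have h6 : 2 * C = 2 * M' * (kap b / R ^ 2) ^ 2 / lam ^ 2 := by
    rw [hC]; field_simp
  rw [h6, div_le_div_iff₀ hl0 (by positivity)] at h5
  have h7 : η * lam ≤ 2 * M' * (kap b / R ^ 2) ^ 2 := by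
    have : η * lam * lam ≤ 2 * M' * (kap b / R ^ 2) ^ 2 * lam := by nlinarith
    exact le_of_mul_le_mul_right this hl0
  have h8 : η * lam = η + 2 * M' * (kap b / R ^ 2) ^ 2 := by
    rw [hlam]; field_simp
  linarith

/-- viscosity subsolution of the viscous Hamilton--Jacobi equation in an open set -/
def HJSub {N : ℕ} (m : ℝ) (U : Set (Euc N × ℝ)) (h v : Euc N × ℝ → ℝ) : Prop :=
  ∀ φ : Euc N × ℝ → ℝ, ContDiff ℝ 2 φ → ∀ p ∈ U, IsLocalMax (fun q => v q - φ q) p →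
    dtE φ p - lpE φ p + ‖grE φ p‖ ^ m ≤ h p

lemma tangent {N : ℕ} {m : ℝ} (hm : 2 < m) (p q : Euc N) :
    ‖q‖ ^ m + inner ℝ ((m * ‖q‖ ^ (m - 2)) • q) (p - q) ≤ ‖p‖ ^ m := by
  rcases eq_or_ne q 0 with rfl | hq
  · simp [Real.zero_rpow (by linarith : m ≠ 0)]
    positivity
  have hq0 : 0 < ‖q‖ := norm_pos_iff.2 hq
  set a := ‖q‖
  set c := ‖p‖
  have hc : 0 ≤ c := norm_nonneg _
  -- Bernoulli
  have h1 : 1 + m * (c / a - 1) ≤ (c / a) ^ m := by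
    have := one_add_mul_self_le_rpow_one_add (s := c / a - 1) (by
      have : 0 ≤ c / a := by positivity
      linarith) (p := m) (by linarith)
    simpa using this
  rw [Real.div_rpow hc hq0.le, le_div_iff₀ (by positivity)] at h1
  have h2 : a ^ m = a ^ (m - 2) * a ^ 2 := by
    rw [← Real.rpow_natCast, ← Real.rpow_add hq0]; norm_num
  rw [inner_smul_left, inner_sub_right, real_inner_self_eq_norm_sq]
  have h3 : inner ℝ q p ≤ a * c := real_inner_le_norm q p
  have h4 : 0 ≤ m * a ^ (m - 2) := by positivity
  have h5 := mul_le_mul_of_nonneg_left h3 h4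
  have h6 : (1 + m * (c / a - 1)) * a ^ m = a ^ m + m * a ^ (m - 2) * (a * c - a ^ 2) := by
    rw [h2]; field_simp
  simp only [conj_trivial]
  nlinarith

lemma ML {N : ℕ} {m : ℝ} (hm : 2 < m) {v h : Euc N × ℝ → ℝ} (hv : Continuous v) (hh : Continuous h)
    {U : Set (Euc N × ℝ)} (hU : IsOpen U) (hsub : HJSub m U h v)
    (ρ : ContDiffBump (0 : Euc N × ℝ)) (hρ : ρ.rOut ≤ 1 / 16) (p0 : Euc N × ℝ)
    (hp0 : closedBall p0 ρ.rOut ⊆ U) :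
    dtE (moll ρ v) p0 - lpE (moll ρ v) p0 + ‖grE (moll ρ v) p0‖ ^ m ≤ moll ρ h p0 := by
  set q := grE (moll ρ v) p0 with hq
  set b := (m * ‖q‖ ^ (m - 2)) • q with hb
  have h1 := LML b hv (h := fun x => h x + (fun _ => inner ℝ b q - ‖q‖ ^ m) x)
    (hh.add continuous_const) hU (fun φ hφ p hp hl => by
      have h2 := hsub φ hφ p hp hl
      have h3 := tangent hm (grE φ p) q
      rw [← hb, inner_sub_right] at h3
      unfold Lop
      simp only
      linarith) ρ hρ p0 hp0
  rw [moll_add ρ hh continuous_const, moll_const] at h1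
  unfold Lop at h1
  rw [← hq] at h1
  linarith
end

open Set Filter Topology Metric MeasureTheory

noncomputable section

/-- the parabolic operator without source -/
def Pop {N : ℕ} (m : ℝ) (φ : Euc N × ℝ → ℝ) (p : Euc N × ℝ) : ℝ :=
  dtE φ p - lpE φ p + ‖grE φ p‖ ^ m

/-- parabolic viscosity subsolution, relaxed boundary condition -/
def PSub {N : ℕ} (Ω : Set (Euc N)) (m : ℝ) (f g : Euc N → ℝ) (v : Euc N × ℝ → ℝ) : Prop :=
  ∀ φ : Euc N × ℝ → ℝ, ContDiff ℝ 2 φ → ∀ x₀ ∈ closure Ω, ∀ t₀ : ℝ, 0 < t₀ →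
    IsLocalMaxOn (fun q => v q - φ q) (closure Ω ×ˢ Iic t₀) (x₀, t₀) →
    Pop m φ (x₀, t₀) ≤ f x₀ ∨ (x₀ ∈ frontier Ω ∧ v (x₀, t₀) ≤ g x₀)

/-- parabolic viscosity supersolution, relaxed boundary condition -/
def PSup {N : ℕ} (Ω : Set (Euc N)) (m : ℝ) (f g : Euc N → ℝ) (v : Euc N × ℝ → ℝ) : Prop :=
  ∀ φ : Euc N × ℝ → ℝ, ContDiff ℝ 2 φ → ∀ x₀ ∈ closure Ω, ∀ t₀ : ℝ, 0 < t₀ →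
    IsLocalMinOn (fun q => v q - φ q) (closure Ω ×ˢ Iic t₀) (x₀, t₀) →
    f x₀ ≤ Pop m φ (x₀, t₀) ∨ (x₀ ∈ frontier Ω ∧ g x₀ ≤ v (x₀, t₀))

section trans
variable {N : ℕ} {Ω : Set (Euc N)} {m : ℝ} {f g u₀ : Euc N → ℝ}

lemma mem_or_frontier (hΩ : IsOpen Ω) {x : Euc N} (hx : x ∈ closure Ω) : x ∈ Ω ∨ x ∈ frontier Ω := by
  rw [hΩ.frontier_eq]
  by_cases h : x ∈ Ω
  · exact Or.inl h
  · exact Or.inr ⟨hx, h⟩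

lemma Pop_cont {φ : Euc N × ℝ → ℝ} (hm : 2 < m) (h : ContDiff ℝ 2 φ) : Continuous (Pop m φ) :=
  ((dtE_cont h).sub (lpE_cont h)).add ((grE_cont h).norm.rpow_const fun _ => Or.inr (by linarith))

lemma PSub.hj {v : Euc N × ℝ → ℝ} (hΩ : IsOpen Ω) (h : PSub Ω m f g v) :
    HJSub m (Ω ×ˢ Ioi (0:ℝ)) (fun p => f p.1) v := by
  rintro φ hφ ⟨x, t⟩ ⟨hx, ht⟩ hl
  rcases h φ hφ x (subset_closure hx) t ht (hl.on _) with h1 | h1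
  · exact h1
  · rw [hΩ.frontier_eq] at h1
    exact absurd hx h1.1.2

lemma sol_PSub (hΩ : IsOpen Ω) {u : Euc N → ℝ → ℝ} (hu : IsGlobalParSol Ω f g u₀ 0 m u)
    {U : Euc N × ℝ → ℝ}
    (hU : ∀ q ∈ closure Ω ×ˢ Ici (0:ℝ), U q = u q.1 q.2) : PSub Ω m f g U := by
  intro φ hφ x hx t ht hl
  have hmem : (x, t) ∈ closure Ω ×ˢ Ioc 0 t := ⟨hx, ht, le_rfl⟩
  have hUx : U (x, t) = u x t := hU (x, t) ⟨hx, ht.le⟩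
  have hl' : IsLocalMaxOn (fun p : Euc N × ℝ => u p.1 p.2 - φ p) (closure Ω ×ˢ Ioc 0 t) (x, t) := by
    have h1 := hl.on_subset (s := closure Ω ×ˢ Ioc 0 t) (prod_mono_right fun s hs => hs.2)
    filter_upwards [h1, self_mem_nhdsWithin] with q hq hqs
    rw [hU q ⟨hqs.1, hqs.2.1.le⟩, hUx] at hq
    exact hq
  obtain ⟨h1, h2⟩ := (hu.2 t ht).1.2.2 φ hφ x t hmem hl'
  rw [parOp_eq] at h1 h2
  rw [hUx]
  unfold Pop
  rcases mem_or_frontier hΩ hx with h | h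
  · exact Or.inl (by linarith [h1 h])
  · rcases min_le_iff.1 (h2 h) with h3 | h3
    · exact Or.inl (by linarith)
    · exact Or.inr ⟨h, by linarith⟩

lemma sol_PSup (hΩ : IsOpen Ω) {u : Euc N → ℝ → ℝ} (hu : IsGlobalParSol Ω f g u₀ 0 m u)
    {U : Euc N × ℝ → ℝ}
    (hU : ∀ q ∈ closure Ω ×ˢ Ici (0:ℝ), U q = u q.1 q.2) : PSup Ω m f g U := by
  intro φ hφ x hx t ht hl
  have hmem : (x, t) ∈ closure Ω ×ˢ Ioc 0 t := ⟨hx, ht, le_rfl⟩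
  have hUx : U (x, t) = u x t := hU (x, t) ⟨hx, ht.le⟩
  have hl' : IsLocalMinOn (fun p : Euc N × ℝ => u p.1 p.2 - φ p) (closure Ω ×ˢ Ioc 0 t) (x, t) := by
    have h1 := hl.on_subset (s := closure Ω ×ˢ Ioc 0 t) (prod_mono_right fun s hs => hs.2)
    filter_upwards [h1, self_mem_nhdsWithin] with q hq hqs
    rw [hU q ⟨hqs.1, hqs.2.1.le⟩, hUx] at hq
    exact hq
  obtain ⟨h1, h2⟩ := (hu.2 t ht).2.2.2 φ hφ x t hmem hl'
  rw [parOp_eq] at h1 h2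
  rw [hUx]
  unfold Pop
  rcases mem_or_frontier hΩ hx with h | h
  · exact Or.inl (by linarith [h1 h])
  · rcases le_max_iff.1 (h2 h) with h3 | h3
    · exact Or.inl (by linarith)
    · exact Or.inr ⟨h, by linarith⟩

lemma Pop_shift {φ : Euc N × ℝ → ℝ} (a p : Euc N × ℝ) :
    Pop m (fun q => φ (q + a)) p = Pop m φ (p + a) := by
  unfold Pop
  rw [dtE_shift, lpE_shift, grE_shift]

lemma shift_tendsto (h : ℝ) (x : Euc N) (t : ℝ) :
    Tendsto (fun q : Euc N × ℝ => q + (0, -h)) (𝓝[closure Ω ×ˢ Iic (t + h)] (x, t + h))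
      (𝓝[closure Ω ×ˢ Iic t] (x, t)) := by
  apply tendsto_nhdsWithin_of_tendsto_nhds_of_eventually_within
  · have : Continuous (fun q : Euc N × ℝ => q + (0, -h)) := by fun_prop
    have h2 := (this.tendsto (x, t + h)).mono_left
      (nhdsWithin_le_nhds (s := closure Ω ×ˢ Iic (t + h)))
    simpa using h2
  · filter_upwards [self_mem_nhdsWithin] with q hq
    have h1 : q.2 ≤ t + h := hq.2
    exact ⟨by simpa using hq.1, by simp; linarith⟩

lemma PSub.shift {v : Euc N × ℝ → ℝ} (hv : PSub Ω m f g v) {h : ℝ} (hh : 0 ≤ h) :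
    PSub Ω m f g (fun q => v (q + (0, h))) := by
  intro φ hφ x hx t ht hl
  have h1 := hv (fun q => φ (q + (0, -h))) (hφ.comp (contDiff_id.add contDiff_const)) x hx (t + h)
    (by linarith) (by
      have := (shift_tendsto (Ω := Ω) h x t).eventually hl
      filter_upwards [this] with q hq
      simpa [add_assoc, Prod.mk_zero_zero] using hq)
  rw [Pop_shift] at h1
  simpa using h1

lemma PSup.shift {v : Euc N × ℝ → ℝ} (hv : PSup Ω m f g v) {h : ℝ} (hh : 0 ≤ h) :
    PSup Ω m f g (fun q => v (q + (0, h))) := by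
  intro φ hφ x hx t ht hl
  have h1 := hv (fun q => φ (q + (0, -h))) (hφ.comp (contDiff_id.add contDiff_const)) x hx (t + h)
    (by linarith) (by
      have := (shift_tendsto (Ω := Ω) h x t).eventually hl
      filter_upwards [this] with q hq
      simpa [add_assoc, Prod.mk_zero_zero] using hq)
  rw [Pop_shift] at h1
  simpa using h1

lemma deriv_nonpos_left {k : ℝ → ℝ} {t : ℝ} (hk : DifferentiableAt ℝ k t)
    (h : ∀ᶠ s in 𝓝[≤] t, k t ≤ k s) : deriv k t ≤ 0 := by
  have h1 := (hasDerivAt_iff_tendsto_slope.1 hk.hasDerivAt).mono_left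
    (nhdsWithin_mono t (fun s (hs : s < t) => hs.ne) : 𝓝[<] t ≤ 𝓝[≠] t)
  refine le_of_tendsto h1 ?_
  filter_upwards [h.filter_mono (nhdsWithin_mono t (fun s (hs : s < t) => hs.le)),
    self_mem_nhdsWithin] with s hs hst
  rw [slope_def_field]
  exact div_nonpos_of_nonneg_of_nonpos (by linarith) (by simp at hst; linarith)

lemma time_tendsto {x : Euc N} (hx : x ∈ closure Ω) (t : ℝ) :
    Tendsto (fun s : ℝ => (x, s)) (𝓝[≤] t) (𝓝[closure Ω ×ˢ Iic t] (x, t)) := by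
  apply tendsto_nhdsWithin_of_tendsto_nhds_of_eventually_within
  · exact ((by fun_prop : Continuous (fun s : ℝ => (x, s))).tendsto t).mono_left nhdsWithin_le_nhds
  · filter_upwards [self_mem_nhdsWithin] with s hs using ⟨hx, hs⟩

lemma space_tendsto {D : Set (Euc N)} (x : Euc N) (t : ℝ) :
    Tendsto (fun y : Euc N => (y, t)) (𝓝[D] x) (𝓝[D ×ˢ Iic t] (x, t)) := by
  apply tendsto_nhdsWithin_of_tendsto_nhds_of_eventually_within
  · exact ((by fun_prop : Continuous (fun y : Euc N => (y, t))).tendsto x).mono_left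
      nhdsWithin_le_nhds
  · filter_upwards [self_mem_nhdsWithin] with s hs using ⟨hs, le_refl t⟩

lemma stat_PSub (hΩ : IsOpen Ω) {w W : Euc N → ℝ} (hw : IsStatSub Ω f g 0 m w)
    (hW : EqOn W w (closure Ω)) : PSub Ω m f g (fun q => W q.1) := by
  intro φ hφ x hx t ht hl
  have ht' : dtE φ (x, t) ≤ 0 := deriv_nonpos_left (slice_td hφ (x, t)) (by
    filter_upwards [(time_tendsto hx t).eventually hl] with s hs
    have hs' : W x - φ (x, s) ≤ W x - φ (x, t) := hs
    linarith)
  have hs : IsLocalMaxOn (w - fun y => φ (y, t)) (closure Ω) x := by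
    filter_upwards [(space_tendsto (D := closure Ω) x t).eventually hl, self_mem_nhdsWithin] with y hy hyD
    simpa [hW hx, hW hyD] using hy
  obtain ⟨h1, h2⟩ := hw.2 _ (slice_x hφ t) x hx hs
  have hop : statOp f 0 m (fun y => φ (y, t)) (w x) x = - lpE φ (x, t) + ‖grE φ (x, t)‖ ^ m - f x := by
    simp [statOp, lpE, grE]
  rw [hop] at h1 h2
  unfold Pop
  simp only [hW hx]
  rcases mem_or_frontier hΩ hx with h | h
  · exact Or.inl (by linarith [h1 h])
  · rcases min_le_iff.1 (h2 h) with h3 | h3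
    · exact Or.inl (by linarith)
    · exact Or.inr ⟨h, by linarith⟩

lemma stat_PSup (hΩ : IsOpen Ω) {w W : Euc N → ℝ} (hw : IsStatSuper Ω f g 0 m w)
    (hW : EqOn W w (closure Ω)) : PSup Ω m f g (fun q => W q.1) := by
  intro φ hφ x hx t ht hl
  have ht' : 0 ≤ dtE φ (x, t) := by
    have := deriv_nonpos_left (k := fun s => - φ (x, s)) (slice_td hφ (x, t)).fun_neg (by
      filter_upwards [(time_tendsto hx t).eventually hl] with s hs
      have hs' : W x - φ (x, t) ≤ W x - φ (x, s) := hs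
      linarith)
    rw [deriv.fun_neg] at this
    unfold dtE
    simp only
    linarith
  have hs : IsLocalMinOn (w - fun y => φ (y, t)) (closure Ω) x := by
    filter_upwards [(space_tendsto (D := closure Ω) x t).eventually hl, self_mem_nhdsWithin] with y hy hyD
    simpa [hW hx, hW hyD] using hy
  obtain ⟨h1, h2⟩ := hw.2 _ (slice_x hφ t) x hx hs
  have hop : statOp f 0 m (fun y => φ (y, t)) (w x) x = - lpE φ (x, t) + ‖grE φ (x, t)‖ ^ m - f x := by
    simp [statOp, lpE, grE]
  rw [hop] at h1 h2
  unfold Pop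
  simp only [hW hx]
  rcases mem_or_frontier hΩ hx with h | h
  · exact Or.inl (by linarith [h1 h])
  · rcases le_max_iff.1 (h2 h) with h3 | h3
    · exact Or.inl (by linarith)
    · exact Or.inr ⟨h, by linarith⟩

lemma sc_HJSub (hΩ : IsOpen Ω) {h w W : Euc N → ℝ} (hw : IsSCSolution Ω h 0 m w)
    (hW : EqOn W w (closure Ω)) {H : Euc N → ℝ} (hH : EqOn H h Ω) (a : ℝ) :
    HJSub m (Ω ×ˢ Ioi (0:ℝ)) (fun p => H p.1) (fun q => W q.1 - a) := by
  rintro φ hφ ⟨x, t⟩ ⟨hx, ht⟩ hl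
  have hxc := subset_closure hx
  have ht' : dtE φ (x, t) ≤ 0 := deriv_nonpos_left (slice_td hφ (x, t)) (by
    filter_upwards [(time_tendsto hxc t).eventually (hl.on (closure Ω ×ˢ Iic t))] with s hs
    have hs' : W x - a - φ (x, s) ≤ W x - a - φ (x, t) := hs
    linarith)
  have hs : IsLocalMaxOn (w - fun y => φ (y, t)) Ω x := by
    filter_upwards [(space_tendsto (D := Ω) x t).eventually (hl.on (Ω ×ˢ Iic t)), self_mem_nhdsWithin] with y hy hyD
    simp only [hW hxc, hW (subset_closure hyD)] at hy
    simp only [Pi.sub_apply]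
    linarith
  have h1 := hw.2.1 _ (slice_x hφ t) x hx hs
  have hop : statOp h 0 m (fun y => φ (y, t)) (w x) x = - lpE φ (x, t) + ‖grE φ (x, t)‖ ^ m - h x := by
    simp [statOp, lpE, grE]
  rw [hop] at h1
  simp only [hH hx]
  linarith

end trans
end

open Set Filter Topology Metric MeasureTheory

noncomputable section

lemma loc_max {N : ℕ} {D : Set (Euc N)} (hD : IsClosed D) {x₀ : Euc N} (hx₀ : x₀ ∈ D) (t₀ : ℝ)
    {r : ℝ} (hr : 0 < r) {k : Euc N × ℝ → ℝ} (hk : Continuous k)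
    (hs : ∀ q ∈ D ×ˢ Iic t₀, dist q (x₀, t₀) = r → k q < k (x₀, t₀)) :
    ∃ x ∈ D, ∃ t ≤ t₀, dist (x, t) (x₀, t₀) < r ∧ IsLocalMaxOn k (D ×ˢ Iic t) (x, t) ∧
      k (x₀, t₀) ≤ k (x, t) := by
  have hp : (x₀, t₀) ∈ closedBall (x₀, t₀) r ∩ D ×ˢ Iic t₀ :=
    ⟨mem_closedBall_self hr.le, hx₀, le_refl t₀⟩
  have hc : IsCompact (closedBall (x₀, t₀) r ∩ D ×ˢ Iic t₀) :=
    (isCompact_closedBall _ _).inter_right (hD.prod isClosed_Iic)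
  obtain ⟨⟨x, t⟩, ⟨hb, hx, ht⟩, hmax⟩ := hc.exists_isMaxOn ⟨_, hp⟩ hk.continuousOn
  have hle : k (x₀, t₀) ≤ k (x, t) := hmax hp
  have hlt : dist (x, t) (x₀, t₀) < r := by
    refine lt_of_le_of_ne hb fun h => ?_
    exact absurd (hs (x, t) ⟨hx, ht⟩ h) (not_lt.2 hle)
  refine ⟨x, hx, t, ht, hlt, ?_, hle⟩
  filter_upwards [self_mem_nhdsWithin, nhdsWithin_le_nhds (isOpen_ball.mem_nhds
    (show (x, t) ∈ ball (x₀, t₀) r from hlt))] with q hq hqb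
  exact hmax ⟨ball_subset_closedBall hqb, hq.1, (le_trans (show q.2 ≤ t from hq.2) ht : q.2 ≤ t₀)⟩

section geo
variable {N : ℕ} {Ω : Set (Euc N)}

lemma closure_rho {ρ : Euc N → ℝ} (hρ : ContDiff ℝ 2 ρ) (hΩρ : Ω = {x | ρ x < 0}) {x : Euc N}
    (hx : x ∈ closure Ω) : ρ x ≤ 0 := by
  have h1 : closure Ω ⊆ {x | ρ x ≤ 0} := by
    apply closure_minimal _ (isClosed_le hρ.continuous continuous_const)
    rw [hΩρ]; exact fun y hy => (show ρ y ≤ 0 from le_of_lt (show ρ y < 0 from hy))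
  exact h1 hx

lemma gradient_cont {ρ : Euc N → ℝ} (hρ : ContDiff ℝ 2 ρ) : Continuous (gradient ρ) := by
  unfold gradient
  have := hρ.continuous_fderiv (by norm_num)
  fun_prop

lemma inward (hΩ : IsOpen Ω) (h2 : HasC2Boundary Ω) {x₀ : Euc N} (hx₀ : x₀ ∈ closure Ω) :
    ∃ n : Euc N, ∃ r > 0, ∃ s₀ > 0, ∀ x ∈ closedBall x₀ r ∩ closure Ω, ∀ s : ℝ, 0 < s → s < s₀ →
      x + s • n ∈ Ω := by
  rcases mem_or_frontier hΩ hx₀ with hx | hx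
  · obtain ⟨r, hr, hrs⟩ := Metric.nhds_basis_closedBall.mem_iff.1 (hΩ.mem_nhds hx)
    exact ⟨0, r, hr, 1, one_pos, fun x hx s _ _ => by simpa using hrs hx.1⟩
  obtain ⟨ρ, hρ, hΩρ, hfr, hgr⟩ := h2
  set n := - gradient ρ x₀ with hn
  have hneg : inner ℝ (gradient ρ x₀) n < 0 := by
    rw [hn, inner_neg_right, real_inner_self_eq_norm_sq]
    have := norm_pos_iff.2 (hgr x₀ hx)
    nlinarith
  have hev : ∀ᶠ y in 𝓝 x₀, inner ℝ (gradient ρ y) n < 0 := by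
    have hc : Continuous fun y => inner ℝ (gradient ρ y) n := (gradient_cont hρ).inner continuous_const
    exact hc.continuousAt.eventually_lt continuousAt_const hneg
  obtain ⟨R, hR, hRs⟩ := Metric.nhds_basis_closedBall.eventually_iff.1 hev
  refine ⟨n, R / 2, by linarith, R / 2 / (‖n‖ + 1), by positivity, fun x hx s hs hs0 => ?_⟩
  have hsn : s * ‖n‖ ≤ R / 2 := by
    rw [lt_div_iff₀ (by positivity)] at hs0
    nlinarith
  have hd : ∀ σ : ℝ, HasDerivAt (fun σ : ℝ => ρ (x + σ • n)) (inner ℝ (gradient ρ (x + σ • n)) n) σ := by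
    intro σ
    have h1 : HasDerivAt (fun σ : ℝ => x + σ • n) n σ := by
      simpa using ((hasDerivAt_id σ).smul_const n).const_add x
    have h3 := ((hρ.differentiable (by norm_num)).differentiableAt
      (x := x + σ • n)).hasFDerivAt.comp_hasDerivAt σ h1
    have h4 : inner ℝ (gradient ρ (x + σ • n)) n = fderiv ℝ ρ (x + σ • n) n := by
      simp [gradient, InnerProductSpace.toDual_symm_apply]
    rw [h4]; exact h3
  have hanti : StrictAntiOn (fun σ : ℝ => ρ (x + σ • n)) (Icc 0 s) := by
    apply strictAntiOn_of_deriv_neg (convex_Icc 0 s)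
    · exact fun σ _ => (hd σ).continuousAt.continuousWithinAt
    · intro σ hσ
      rw [interior_Icc] at hσ
      rw [(hd σ).deriv]
      apply hRs
      rw [mem_closedBall, dist_eq_norm]
      have h5 : ‖x - x₀‖ ≤ R / 2 := by simpa [dist_eq_norm] using hx.1
      have h6 : ‖σ • n‖ ≤ R / 2 := by
        rw [norm_smul, Real.norm_eq_abs, abs_of_pos hσ.1]
        exact (mul_le_mul_of_nonneg_right hσ.2.le (norm_nonneg _)).trans hsn
      calc ‖x + σ • n - x₀‖ = ‖(x - x₀) + σ • n‖ := by congr 1; abel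
        _ ≤ R := (norm_add_le _ _).trans (by linarith)
  have h7 := hanti (left_mem_Icc.2 hs.le) (right_mem_Icc.2 hs.le) hs
  simp only [zero_smul, add_zero] at h7
  rw [hΩρ]
  exact h7.trans_le (closure_rho hρ hΩρ hx.2)

lemma space_fun {k : Euc N → ℝ} (p : Euc N × ℝ) :
    dtE (fun q => k q.1) p = 0 ∧ grE (fun q => k q.1) p = gradient k p.1 ∧
      lpE (fun q => k q.1) p = lapl k p.1 := by
  refine ⟨by simp [dtE], rfl, rfl⟩

lemma bl (hΩ : IsOpen Ω) (h2 : HasC2Boundary Ω) {m : ℝ} (hm : 2 < m) {f g : Euc N → ℝ}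
    (hf : Continuous f) (hg : ContinuousOn g (frontier Ω)) {v : Euc N × ℝ → ℝ} (hv : Continuous v)
    (hsub : PSub Ω m f g v) {x₀ : Euc N} (hx₀ : x₀ ∈ frontier Ω) {t₀ : ℝ} (ht₀ : 0 < t₀) :
    v (x₀, t₀) ≤ g x₀ := by
  by_contra hc
  push Not at hc
  have hx₀c : x₀ ∈ closure Ω := frontier_subset_closure hx₀
  obtain ⟨ρ, hρ, hΩρ, hfr, hgr⟩ := h2
  have hρx₀ : ρ x₀ = 0 := by rw [hfr] at hx₀; exact hx₀
  -- radius for g < v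
  obtain ⟨a, ha1, ha2⟩ := exists_between hc
  have e1 : ∀ᶠ x in 𝓝 x₀, x ∈ frontier Ω → g x < a :=
    eventually_nhdsWithin_iff.1 ((hg x₀ hx₀).eventually (gt_mem_nhds ha1))
  have e2 : ∀ᶠ q in 𝓝 (x₀, t₀), a < v q := hv.continuousAt.eventually (lt_mem_nhds ha2)
  have hgpos := norm_pos_iff.2 (hgr x₀ hx₀)
  set c0 := ‖gradient ρ x₀‖ / 2 with hc0
  have hc0p : 0 < c0 := by positivity
  have e3 : ∀ᶠ x in 𝓝 x₀, c0 < ‖gradient ρ x‖ :=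
    (gradient_cont hρ).norm.continuousAt.eventually (lt_mem_nhds (by linarith))
  obtain ⟨r1, hr1, h1⟩ := Metric.nhds_basis_closedBall.eventually_iff.1 (e1.and e3)
  obtain ⟨r2, hr2, h2⟩ := Metric.nhds_basis_closedBall.eventually_iff.1 e2
  obtain ⟨r, hr, hrr1, hrr2, hrt⟩ : ∃ r > 0, r ≤ r1 ∧ r ≤ r2 ∧ r ≤ t₀ :=
    ⟨min r1 (min r2 t₀), by positivity, min_le_left _ _, (min_le_right _ _).trans (min_le_left _ _),
      (min_le_right _ _).trans (min_le_right _ _)⟩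
  have hcomp := isCompact_closedBall (x₀, t₀) r
  obtain ⟨V, hV⟩ := hcomp.exists_bound_of_continuousOn hv.continuousOn
  have hV0 : 0 ≤ V := (norm_nonneg _).trans (hV _ (mem_closedBall_self hr.le))
  have hlc : Continuous (fun p : Euc N × ℝ => lpE (fun q : Euc N × ℝ => ρ q.1) p) :=
    lpE_cont (hρ.comp contDiff_fst)
  obtain ⟨K2, hK2⟩ := hcomp.exists_bound_of_continuousOn hlc.continuousOn
  obtain ⟨Fb, hFb⟩ := hcomp.exists_bound_of_continuousOn (hf.comp continuous_fst).continuousOn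
  set A := (2 * V + 1) / r ^ 2 with hA
  have hA0 : 0 < A := by positivity
  have hAr : A * r ^ 2 = 2 * V + 1 := by rw [hA]; field_simp
  -- choose C
  have hK20 : 0 ≤ K2 := (norm_nonneg _).trans (hK2 _ (mem_closedBall_self hr.le))
  have hFb0 : 0 ≤ Fb := (norm_nonneg _).trans (hFb _ (mem_closedBall_self hr.le))
  obtain ⟨C, hC0, hC1, hC2, hC3⟩ : ∃ C : ℝ, 0 < C ∧ 1 ≤ C * c0 / 2 ∧ 2 * A * r ≤ C * c0 / 2 ∧
      Fb + 2 * A * r + 2 * N * A + C * K2 < (C * c0 / 2) ^ 2 := by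
    have t1 : Tendsto (fun C : ℝ => C * c0 / 2) atTop atTop := by
      apply Tendsto.atTop_div_const (by norm_num)
      exact tendsto_id.atTop_mul_const hc0p
    have t2 : ∀ᶠ C : ℝ in atTop, Fb + 2 * A * r + 2 * N * A + C * K2 < (C * c0 / 2) ^ 2 := by
      filter_upwards [eventually_ge_atTop 1, eventually_gt_atTop
        ((Fb + 2 * A * r + 2 * N * A + K2) / (c0 / 2) ^ 2)] with C hC1 hC2
      rw [div_lt_iff₀ (by positivity)] at hC2
      have h3 : 0 ≤ Fb + 2 * A * r + 2 * N * A := by positivity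
      have h4 : (C * c0 / 2) ^ 2 = C * (C * (c0 / 2) ^ 2) := by ring
      rw [h4]
      nlinarith
    obtain ⟨C, hC⟩ := ((eventually_gt_atTop 0).and ((t1.eventually_ge_atTop 1).and
      ((t1.eventually_ge_atTop (2 * A * r)).and t2))).exists
    exact ⟨C, hC⟩
  set φ : Euc N × ℝ → ℝ := fun q => (fun q => A * qd (x₀, t₀) q) q + (fun q => (-C) * ρ q.1) q with hφ
  have hq2 : ContDiff ℝ 2 (fun q => A * qd (x₀, t₀) q) := contDiff_const.mul (qd_contDiff _)
  have hρ2 : ContDiff ℝ 2 (fun q : Euc N × ℝ => ρ q.1) := hρ.comp contDiff_fst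
  have hφ2 : ContDiff ℝ 2 φ := hq2.add (contDiff_const.mul hρ2)
  obtain ⟨x, hx, t, ht, hd, hl, hle⟩ := loc_max isClosed_closure hx₀c t₀ hr
    (k := fun q => v q - φ q) (hv.sub hφ2.continuous) (fun q hq hqr => by
      have h3 : ρ q.1 ≤ 0 := closure_rho hρ hΩρ hq.1
      have h4 := qd_ge (a := (x₀, t₀)) (q := q)
      rw [hqr] at h4
      have h5 := abs_le.1 (hV q (by rw [mem_closedBall, hqr]))
      have h6 := abs_le.1 (hV _ (mem_closedBall_self hr.le))
      have h7 := mul_le_mul_of_nonneg_left h4 hA0.le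
      simp only [hφ, qd_self, hρx₀]
      nlinarith [h5.2, h6.1])
  have hxt : (x, t) ∈ closedBall (x₀, t₀) r := ball_subset_closedBall hd
  have hdx : dist x x₀ ≤ r := (le_max_left _ _).trans hd.le
  have hdt : |t - t₀| < r := (le_max_right (dist x x₀) (dist t t₀)).trans_lt hd
  have ht0 : 0 < t := by linarith [(abs_lt.1 hdt).1]
  obtain ⟨hg1, hg2⟩ := h1 (closedBall_subset_closedBall hrr1 (show x ∈ closedBall x₀ r from hdx))
  have hv1 := h2 (closedBall_subset_closedBall hrr2 hxt)
  rcases hsub φ hφ2 x hx t ht0 hl with h3 | h3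
  · have hgr : grE φ (x, t) = (2 * A) • (x - x₀) - C • gradient ρ x := by
      rw [hφ, grE_add hq2 (contDiff_const.mul hρ2), grE_cmul _ (qd_contDiff _), grE_cmul _ hρ2, grE_qd,
        (space_fun (k := ρ) _).2.1, smul_smul]
      simp [mul_comm, sub_eq_add_neg]
    have hlp : lpE φ (x, t) = A * (2 * N) - C * lpE (fun q : Euc N × ℝ => ρ q.1) (x, t) := by
      rw [hφ, lpE_add hq2 (contDiff_const.mul hρ2), lpE_cmul _ (qd_contDiff _), lpE_cmul _ hρ2, lpE_qd]
      ring
    have hdt' : dtE φ (x, t) = A * (2 * (t - t₀)) := by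
      rw [hφ, dtE_add hq2 (contDiff_const.mul hρ2), dtE_cmul _ (qd_contDiff _), dtE_cmul _ hρ2, dtE_qd,
        (space_fun (k := ρ) _).1]
      ring
    have hnorm : C * c0 / 2 ≤ ‖grE φ (x, t)‖ := by
      rw [hgr]
      have h4 := norm_sub_norm_le (C • gradient ρ x) ((2 * A) • (x - x₀))
      rw [norm_sub_rev, norm_smul, norm_smul, Real.norm_eq_abs, abs_of_pos hC0, Real.norm_eq_abs,
        abs_of_pos (by positivity : 0 < 2 * A), ← dist_eq_norm x x₀] at h4
      have h5 : 2 * A * dist x x₀ ≤ 2 * A * r := by gcongr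
      have h6 : C * c0 ≤ C * ‖gradient ρ x‖ := by gcongr
      linarith
    have hpow : (C * c0 / 2) ^ 2 ≤ ‖grE φ (x, t)‖ ^ m := by
      calc (C * c0 / 2) ^ 2 = (C * c0 / 2) ^ (2:ℝ) := by norm_cast
        _ ≤ (C * c0 / 2) ^ m := Real.rpow_le_rpow_of_exponent_le hC1 hm.le
        _ ≤ _ := Real.rpow_le_rpow (by linarith) hnorm (by linarith)
    have h7 := abs_le.1 (hK2 _ hxt)
    have h8 := abs_le.1 (hFb _ hxt)
    simp only [Function.comp] at h8
    unfold Pop at h3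
    rw [hlp, hdt'] at h3
    have h9 : -(2 * A * r) ≤ A * (2 * (t - t₀)) := by nlinarith [(abs_lt.1 hdt).1]
    have h10 := mul_le_mul_of_nonneg_left h7.1 hC0.le
    linarith [h8.2]
  · linarith [hg1 h3.1, h3.2]

end geo

lemma lin_fun {N : ℕ} (K : ℝ) (e : Euc N) (p : Euc N × ℝ) :
    ContDiff ℝ 2 (fun q : Euc N × ℝ => inner ℝ (K • e) q.1) ∧
    dtE (fun q : Euc N × ℝ => inner ℝ (K • e) q.1) p = 0 ∧
    grE (fun q : Euc N × ℝ => inner ℝ (K • e) q.1) p = K • e ∧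
    lpE (fun q : Euc N × ℝ => inner ℝ (K • e) q.1) p = 0 := by
  have hA : ∀ y : Euc N, HasGradientAt (fun y => inner ℝ (K • e) y) (K • e) y := fun y => by
    rw [hasGradientAt_iff_hasFDerivAt]
    exact (InnerProductSpace.toDual ℝ (Euc N) (K • e)).hasFDerivAt
  have hc : ContDiff ℝ 2 (fun y : Euc N => inner ℝ (K • e) y) := contDiff_const.inner ℝ contDiff_id
  refine ⟨hc.comp contDiff_fst, (space_fun (k := fun y => inner ℝ (K • e) y) p).1, ?_, ?_⟩
  · rw [(space_fun (k := fun y => inner ℝ (K • e) y) p).2.1]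
    exact (hA p.1).gradient
  · rw [(space_fun (k := fun y => inner ℝ (K • e) y) p).2.2,
      lapl_of (fun _ => K • e) hA p.1 (fun _ => 0) hc (fun i => hasFDerivAt_const _ _)]
    simp

lemma upper_bd {N : ℕ} (hN : 1 ≤ N) {Ω : Set (Euc N)} (hΩ : IsOpen Ω) (hb : Bornology.IsBounded Ω)
    {m : ℝ} (hm : 2 < m) {f g : Euc N → ℝ} (hf : Continuous f) {v : Euc N × ℝ → ℝ}
    (hv : Continuous v) (hsub : PSub Ω m f g v) {B : ℝ} (h0 : ∀ x ∈ closure Ω, v (x, 0) ≤ B)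
    (hbd : ∀ x ∈ frontier Ω, ∀ t > 0, v (x, t) ≤ B) :
    ∃ C, ∀ x ∈ closure Ω, ∀ t, 0 ≤ t → v (x, t) ≤ C := by
  have hcomp : IsCompact (closure Ω) := hb.isCompact_closure
  obtain ⟨Fb, hFb⟩ := hcomp.exists_bound_of_continuousOn hf.continuousOn
  set K := max 1 (Fb + 1) with hK
  set e : Euc N := EuclideanSpace.single ⟨0, hN⟩ 1 with he
  have hen : ‖e‖ = 1 := by simp [he]
  obtain ⟨Lb, hLb⟩ := hcomp.exists_bound_of_continuousOn
    (f := fun x : Euc N => inner ℝ (K • e) x) (by fun_prop)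
  refine ⟨B + 2 * Lb, fun x hx t ht => ?_⟩
  obtain ⟨⟨x₀, t₀⟩, ⟨hx₀, ht₀⟩, hmax⟩ := (hcomp.prod (isCompact_Icc (a := 0) (b := t))).exists_isMaxOn
    ⟨(x, t), hx, ht, le_refl t⟩ (f := fun q : Euc N × ℝ => v q - inner ℝ (K • e) q.1) (by fun_prop)
  have h1 : v (x, t) - inner ℝ (K • e) x ≤ v (x₀, t₀) - inner ℝ (K • e) x₀ := hmax ⟨hx, ht, le_refl t⟩
  have hl1 := abs_le.1 (hLb x hx)
  have hl2 := abs_le.1 (hLb x₀ hx₀)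
  suffices v (x₀, t₀) ≤ B by linarith [hl1.2, hl2.1]
  rcases eq_or_lt_of_le ht₀.1 with h | h
  · simp only at h; rw [← h]; exact h0 x₀ hx₀
  rcases mem_or_frontier hΩ hx₀ with hxi | hxf
  swap
  · exact hbd x₀ hxf t₀ h
  exfalso
  obtain ⟨l1, l2, l3, l4⟩ := lin_fun K e (x₀, t₀)
  rcases hsub _ l1 x₀ hx₀ t₀ h (by
    filter_upwards [self_mem_nhdsWithin, nhdsWithin_le_nhds
      ((isOpen_univ.prod isOpen_Ioi).mem_nhds (show (x₀, t₀) ∈ univ ×ˢ Ioi (0:ℝ) from ⟨trivial, h⟩))] with q hq hq2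
    exact hmax ⟨hq.1, le_of_lt (show (0:ℝ) < q.2 from hq2.2), le_trans (show q.2 ≤ t₀ from hq.2) ht₀.2⟩) with h3 | h3
  · unfold Pop at h3
    rw [l2, l3, l4, norm_smul, hen, Real.norm_eq_abs, abs_of_pos (lt_max_of_lt_left one_pos), mul_one] at h3
    have h4 : K ≤ K ^ m := by
      calc K = K ^ (1:ℝ) := (Real.rpow_one K).symm
        _ ≤ K ^ m := Real.rpow_le_rpow_of_exponent_le (le_max_left _ _) (by linarith)
    have h5 := (abs_le.1 (hFb x₀ hx₀)).2
    have h6 : Fb + 1 ≤ K := le_max_right _ _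
    linarith
  · rw [hΩ.frontier_eq] at h3
    exact h3.1.2 hxi
end

open Set Filter Topology Metric MeasureTheory

noncomputable section

lemma norm_conv {N : ℕ} {m : ℝ} (hm : 2 < m) {s : ℝ} (h0 : 0 ≤ s) (h1 : s ≤ 1) (a b : Euc N) :
    ‖s • a + (1 - s) • b‖ ^ m ≤ s * ‖a‖ ^ m + (1 - s) * ‖b‖ ^ m := by
  have h2 : ‖s • a + (1 - s) • b‖ ≤ s * ‖a‖ + (1 - s) * ‖b‖ := by
    refine (norm_add_le _ _).trans ?_
    rw [norm_smul, norm_smul, Real.norm_eq_abs, Real.norm_eq_abs, abs_of_nonneg h0,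
      abs_of_nonneg (sub_nonneg.2 h1)]
  refine (Real.rpow_le_rpow (norm_nonneg _) h2 (by linarith)).trans ?_
  have := (convexOn_rpow (p := m) (by linarith)).2 (mem_Ici.2 (norm_nonneg a)) (mem_Ici.2 (norm_nonneg b))
    h0 (sub_nonneg.2 h1) (by ring)
  simpa using this

lemma tconv_contDiff {N : ℕ} {A B : Euc N × ℝ → ℝ} (hA : ContDiff ℝ 2 A) (hB : ContDiff ℝ 2 B)
    {θ : ℝ → ℝ} (hθ : ContDiff ℝ 2 θ) : ContDiff ℝ 2 (fun q => θ q.2 * A q + (1 - θ q.2) * B q) :=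
  ((hθ.comp contDiff_snd).mul hA).add ((contDiff_const.sub (hθ.comp contDiff_snd)).mul hB)

lemma Pop_tconv {N : ℕ} {m : ℝ} (hm : 2 < m) {A B : Euc N × ℝ → ℝ} (hA : ContDiff ℝ 2 A)
    (hB : ContDiff ℝ 2 B) {θ : ℝ → ℝ} (hθ : ContDiff ℝ 2 θ) (p : Euc N × ℝ) (h0 : 0 ≤ θ p.2)
    (h1 : θ p.2 ≤ 1) :
    Pop m (fun q => θ q.2 * A q + (1 - θ q.2) * B q) p ≤
      θ p.2 * Pop m A p + (1 - θ p.2) * Pop m B p + deriv θ p.2 * (A p - B p) := by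
  have hd : Differentiable ℝ θ := hθ.differentiable (by norm_num)
  have e1 : ContDiff ℝ 2 (fun q : Euc N × ℝ => θ q.2 * A q) := (hθ.comp contDiff_snd).mul hA
  have e2 : ContDiff ℝ 2 (fun q : Euc N × ℝ => (fun t => 1 - θ t) q.2 * B q) :=
    (contDiff_const.sub (hθ.comp contDiff_snd)).mul hB
  have hd2 : deriv (fun t => 1 - θ t) p.2 = - deriv θ p.2 := by
    simp
  unfold Pop
  have k1 : dtE (fun q => θ q.2 * A q + (1 - θ q.2) * B q) p = _ := dtE_add e1 e2 p
  have k2 : lpE (fun q => θ q.2 * A q + (1 - θ q.2) * B q) p = _ := lpE_add e1 e2 p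
  have k3 : grE (fun q => θ q.2 * A q + (1 - θ q.2) * B q) p = _ := grE_add e1 e2 p
  rw [dtE_tmul θ hd hA, dtE_tmul (fun t => 1 - θ t) ((differentiable_const _).sub hd) hB, hd2] at k1
  rw [lpE_tmul θ hA, lpE_tmul (fun t => 1 - θ t) hB] at k2
  rw [grE_tmul θ hA, grE_tmul (fun t => 1 - θ t) hB] at k3
  rw [k1, k2, k3]
  have := norm_conv hm h0 h1 (grE A p) (grE B p)
  nlinarith

section
variable {N : ℕ} {Ω : Set (Euc N)}

set_option maxHeartbeats 1000000 in
lemma appr (hΩ : IsOpen Ω) (h2 : HasC2Boundary Ω) {m : ℝ} (hm : 2 < m) {x₀ : Euc N}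
    (hx₀ : x₀ ∈ closure Ω) {t₀ : ℝ} (ht₀ : 0 < t₀) :
    ∃ r > 0, r < t₀ ∧ ∀ v h : Euc N × ℝ → ℝ, Continuous v → Continuous h →
      HJSub m (Ω ×ˢ Ioi 0) h v → ∀ τ > 0, ∃ A : Euc N × ℝ → ℝ, ContDiff ℝ 2 A ∧
      ∀ q ∈ closedBall (x₀, t₀) r ∩ closure Ω ×ˢ Iic t₀, |A q - v q| ≤ τ ∧ Pop m A q ≤ h q + τ := by
  obtain ⟨n, R, hR, s₀, hs₀, hin⟩ := inward hΩ h2 hx₀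
  obtain ⟨r, hr, hrR, hrt⟩ : ∃ r > 0, r ≤ R ∧ r < t₀ :=
    ⟨min R (t₀ / 2), by positivity, min_le_left _ _, (min_le_right _ _).trans_lt (by linarith)⟩
  refine ⟨r, hr, hrt, fun v h hv hh hsub τ hτ => ?_⟩
  have hU : IsOpen (Ω ×ˢ Ioi (0:ℝ)) := hΩ.prod isOpen_Ioi
  set Q := closedBall (x₀, t₀) r ∩ closure Ω ×ˢ Iic t₀ with hQ
  have hQc : IsCompact Q := (isCompact_closedBall _ _).inter_right (isClosed_closure.prod isClosed_Iic)
  have hQt : ∀ q ∈ Q, 0 < q.2 := fun q hq => by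
    have h3 : |q.2 - t₀| ≤ r := (le_max_right (dist q.1 x₀) (dist q.2 t₀)).trans hq.1
    linarith [(abs_le.1 h3).1]
  -- uniform continuity
  have huc : ∀ G : Euc N × ℝ → ℝ, Continuous G → ∃ d > 0, d ≤ 1 ∧ ∀ q ∈ Q, ∀ y, dist y q ≤ d →
      |G y - G q| ≤ τ := by
    intro G hG
    have := (isCompact_closedBall (x₀, t₀) (r + 1)).uniformContinuousOn_of_continuous hG.continuousOn
    obtain ⟨d, hd, hd2⟩ := Metric.uniformContinuousOn_iff.1 this τ hτ
    refine ⟨min (d / 2) 1, by positivity, min_le_right _ _, fun q hq y hy => ?_⟩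
    have hq1 : dist q (x₀, t₀) ≤ r := hq.1
    have := hd2 y (by
      rw [mem_closedBall]
      have := dist_triangle y q (x₀, t₀)
      have := hy.trans (min_le_right _ _)
      linarith) q (by rw [mem_closedBall]; linarith) (by
        have := hy.trans (min_le_left _ _)
        linarith)
    exact this.le
  obtain ⟨d1, hd1, hd1', hv1⟩ := huc v hv
  obtain ⟨d2, hd2, hd2', hh1⟩ := huc h hh
  obtain ⟨d, hd, hdd1, hdd2⟩ : ∃ d > 0, d ≤ d1 ∧ d ≤ d2 :=
    ⟨min d1 d2, by positivity, min_le_left _ _, min_le_right _ _⟩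
  obtain ⟨s, hs, hss, hsd⟩ : ∃ s > 0, s < s₀ ∧ s * ‖n‖ ≤ d / 2 := by
    refine ⟨min (s₀ / 2) (d / (2 * (‖n‖ + 1))), by positivity,
      (min_le_left _ _).trans_lt (by linarith), ?_⟩
    calc min (s₀ / 2) (d / (2 * (‖n‖ + 1))) * ‖n‖ ≤ d / (2 * (‖n‖ + 1)) * (‖n‖ + 1) := by
          gcongr
          · exact min_le_right _ _
          · linarith
      _ = d / 2 := by field_simp
  set a : Euc N × ℝ := (s • n, 0) with ha
  have hna : ‖a‖ ≤ d / 2 := by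
    rw [ha, Prod.norm_def]
    simp only [norm_zero, norm_smul, Real.norm_eq_abs, abs_of_pos hs]
    exact max_le hsd (by positivity)
  set S := (fun q => q + a) '' Q with hS
  have hSc : IsCompact S := hQc.image (by fun_prop)
  have hSU : S ⊆ Ω ×ˢ Ioi 0 := by
    rintro _ ⟨q, hq, rfl⟩
    refine ⟨?_, ?_⟩
    · have h3 : dist q.1 x₀ ≤ r := (le_max_left _ (dist q.2 t₀)).trans hq.1
      exact hin q.1 ⟨mem_closedBall.2 (h3.trans hrR), hq.2.1⟩ s hs hss
    · simpa [ha] using hQt q hq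
  obtain ⟨ε, hε, hεU⟩ := hSc.exists_cthickening_subset_open hU hSU
  set ro := min (d / 2) (min (1 / 16) ε) with hro
  have hrop : 0 < ro := by positivity
  let ρ : ContDiffBump (0 : Euc N × ℝ) := ⟨ro / 2, ro, by linarith, by linarith⟩
  have hρ1 : ρ.rOut ≤ d / 2 := min_le_left _ _
  have hρ2 : ρ.rOut ≤ 1 / 16 := (min_le_right _ _).trans (min_le_left _ _)
  have hρ3 : ρ.rOut ≤ ε := (min_le_right _ _).trans (min_le_right _ _)
  have hdist : ∀ q, ∀ y ∈ closedBall (q + a) ρ.rOut, dist y q ≤ d := by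
    intro q y hy
    have h3 := dist_triangle y (q + a) q
    have h4 : dist (q + a) q = ‖a‖ := by rw [dist_eq_norm]; congr 1; abel
    rw [mem_closedBall] at hy
    linarith
  have hbU : ∀ q ∈ Q, closedBall (q + a) ρ.rOut ⊆ Ω ×ˢ Ioi 0 := by
    intro q hq
    have h3 : q + a ∈ S := ⟨q, hq, rfl⟩
    exact (closedBall_subset_closedBall hρ3).trans ((closedBall_subset_cthickening h3 ε).trans hεU)
  clear_value ρ
  refine ⟨fun q => moll ρ v (q + a), (moll_contDiff ρ hv).comp (contDiff_id.add contDiff_const),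
    fun q hq => ⟨?_, ?_⟩⟩
  · exact moll_close ρ hv (q + a) fun y hy => hv1 q hq y ((hdist q y hy).trans hdd1)
  · have h3 := moll_close ρ hh (q + a) fun y hy => hh1 q hq y ((hdist q y hy).trans hdd2)
    have h4 := ML hm hv hh hU hsub ρ hρ2 (q + a)
      (hbU q hq)
    rw [Pop_shift]
    have h5 := (abs_le.1 h3).2
    unfold Pop
    linarith

set_option maxHeartbeats 2000000 in
theorem comp (hΩ : IsOpen Ω) (hb : Bornology.IsBounded Ω) (hC2 : HasC2Boundary Ω) {m : ℝ}
    (hm : 2 < m) {f g ψ : Euc N → ℝ} (hf : Continuous f) (hψc : Continuous ψ) {c : ℝ} (hc : c < 0)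
    {v1 v2 : Euc N × ℝ → ℝ} (hv1 : Continuous v1) (hv2 : Continuous v2)
    (h1 : HJSub m (Ω ×ˢ Ioi 0) (fun p => f p.1) v1)
    (hb1 : ∀ x ∈ frontier Ω, ∀ t > 0, v1 (x, t) ≤ g x)
    (h2 : PSup Ω m f g v2)
    (hψ : HJSub m (Ω ×ˢ Ioi 0) (fun p => f p.1 + c) (fun p => ψ p.1))
    (hψg : ∀ x ∈ frontier Ω, ψ x ≤ g x) (hψ0 : ∀ x ∈ closure Ω, ψ x ≤ v2 (x, 0))
    {δ : ℝ} (hδ : 0 < δ) (hδ1 : ∀ x ∈ closure Ω, ∀ t, 0 ≤ t → δ * (v1 (x, t) - ψ x) ≤ -c / 4)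
    {x : Euc N} (hx : x ∈ closure Ω) {t : ℝ} (ht : 0 ≤ t) :
    (1 - Real.exp (-(δ * t))) * v1 (x, t) + Real.exp (-(δ * t)) * ψ x ≤ v2 (x, t) := by
  by_contra hcon
  push Not at hcon
  set θ : ℝ → ℝ := fun t => 1 - Real.exp (-(δ * t)) with hθ
  have hθ2 : ContDiff ℝ 2 θ := by rw [hθ]; fun_prop
  have hθd : ∀ t, deriv θ t = δ * Real.exp (-(δ * t)) := by
    intro t
    have h3 : HasDerivAt (fun t => -(δ * t)) (-δ) t := by
      simpa using! ((hasDerivAt_id t).const_mul δ).neg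
    have := (h3.exp.const_sub 1).deriv
    rw [hθ, this]; ring
  set z : Euc N × ℝ → ℝ := fun q => θ q.2 * v1 q + (1 - θ q.2) * ψ q.1 with hz
  have hθc : Continuous θ := hθ2.continuous
  have hzc : Continuous z := by rw [hz]; fun_prop
  obtain ⟨⟨x₀, t₀⟩, ⟨hx₀, ht₀⟩, hmax⟩ := (hb.isCompact_closure.prod
    (isCompact_Icc (a := 0) (b := t))).exists_isMaxOn ⟨(x, t), hx, ht, le_refl t⟩
    (f := fun q : Euc N × ℝ => z q - v2 q) (hzc.sub hv2).continuousOn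
  set p : Euc N × ℝ := (x₀, t₀) with hp
  set d0 := z p - v2 p with hd0
  have hd0p : 0 < d0 := by
    have h3 : z (x, t) - v2 (x, t) ≤ d0 := hmax ⟨hx, ht, le_refl t⟩
    have h4 : z (x, t) = (1 - Real.exp (-(δ * t))) * v1 (x, t) + Real.exp (-(δ * t)) * ψ x := by
      simp [hz, hθ]
    linarith
  have ht₀p : 0 < t₀ := by
    rcases eq_or_lt_of_le ht₀.1 with h | h
    · exfalso
      simp only [hp] at h
      have := hψ0 x₀ hx₀
      have h5 : d0 = ψ x₀ - v2 (x₀, 0) := by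
        rw [hd0, hp, ← h]; simp [hz, hθ]
      linarith
    · exact h
  have hmax' : ∀ q ∈ closure Ω ×ˢ Iic t₀, 0 ≤ q.2 → z q - v2 q ≤ d0 := fun q hq hq0 =>
    hmax ⟨hq.1, hq0, le_trans (show q.2 ≤ t₀ from hq.2) ht₀.2⟩
  obtain ⟨r, hr, hrt, happ⟩ := appr hΩ hC2 hm hx₀ ht₀p
  obtain ⟨Zb, hZb⟩ := (isCompact_closedBall p r).exists_bound_of_continuousOn hzc.continuousOn
  have hZb0 : 0 ≤ Zb := (norm_nonneg _).trans (hZb _ (mem_closedBall_self hr.le))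
  obtain ⟨Fb, hFb⟩ := (isCompact_closedBall p r).exists_bound_of_continuousOn
    (hf.comp continuous_fst).continuousOn
  have hFb0 : 0 ≤ Fb := (norm_nonneg _).trans (hFb _ (mem_closedBall_self hr.le))
  set κ := (2 * Zb + 1) / r ^ 2 with hκ
  have hκ0 : 0 < κ := by positivity
  have hκr : κ * r ^ 2 = 2 * Zb + 1 := by rw [hκ]; field_simp
  set ζ : Euc N × ℝ → ℝ := fun q => z p - κ * qd p q with hζ
  have hζ2 : ContDiff ℝ 2 ζ := contDiff_const.sub (contDiff_const.mul (qd_contDiff _))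
  obtain ⟨K, hK⟩ := (isCompact_closedBall p r).exists_bound_of_continuousOn (Pop_cont hm hζ2).continuousOn
  have hK0 : 0 ≤ K := (norm_nonneg _).trans (hK _ (mem_closedBall_self hr.le))
  set e0 := Real.exp (-(δ * t₀)) with he0
  have he0p : 0 < e0 := Real.exp_pos _
  have hec : 0 < -(e0 * c) := by nlinarith
  obtain ⟨ν, hν, hν2, hν3, hν4⟩ : ∃ ν > 0, ν ≤ 1 / 2 ∧ ν * (K + Fb) < -(e0 * c) / 8 ∧ 2 * Zb * ν < d0 / 2 := by
    have t1 : Tendsto (fun ν : ℝ => ν * (K + Fb)) (𝓝[>] 0) (𝓝 (0 * (K + Fb))) :=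
      (Continuous.tendsto (by fun_prop) 0).mono_left nhdsWithin_le_nhds
    have t2 : Tendsto (fun ν : ℝ => 2 * Zb * ν) (𝓝[>] 0) (𝓝 (2 * Zb * 0)) :=
      (Continuous.tendsto (by fun_prop) 0).mono_left nhdsWithin_le_nhds
    obtain ⟨ν, a1, a2, a3, a4⟩ := ((show ∀ᶠ ν : ℝ in 𝓝[>] 0, 0 < ν from self_mem_nhdsWithin).and ((eventually_nhdsWithin_of_eventually_nhds
      (gt_mem_nhds (show (0:ℝ) < 1 / 2 by norm_num))).and ((t1.eventually (gt_mem_nhds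
        (show 0 * (K + Fb) < -(e0 * c) / 8 by linarith))).and (t2.eventually (gt_mem_nhds
        (show 2 * Zb * 0 < d0 / 2 by linarith)))))).exists
    exact ⟨ν, a1, le_of_lt a2, a3, a4⟩
  obtain ⟨τ, hτ, hτ1, hτ2, hτ3, hτ4⟩ : ∃ τ > 0, 2 * τ < ν ∧ 2 * τ < d0 / 2 ∧ δ * τ ≤ -c / 8 ∧
      τ ≤ -(e0 * c) / 4 := by
    refine ⟨min (min (ν / 4) (d0 / 8)) (min (-c / 8 / δ) (-(e0 * c) / 4)), ?_, ?_, ?_, ?_, ?_⟩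
    · have : 0 < -c := by linarith
      positivity
    · have := (min_le_left (min (ν / 4) (d0 / 8)) (min (-c / 8 / δ) (-(e0 * c) / 4))).trans (min_le_left _ _)
      linarith
    · have := (min_le_left (min (ν / 4) (d0 / 8)) (min (-c / 8 / δ) (-(e0 * c) / 4))).trans (min_le_right _ _)
      linarith
    · have := (min_le_right (min (ν / 4) (d0 / 8)) (min (-c / 8 / δ) (-(e0 * c) / 4))).trans (min_le_left _ _)
      rw [le_div_iff₀ hδ] at this
      linarith
    · exact (min_le_right _ _).trans (min_le_right _ _)
  obtain ⟨A, hA2, hA⟩ := happ v1 (fun p => f p.1) hv1 (by fun_prop) h1 τ hτ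
  obtain ⟨B, hB2, hB⟩ := happ (fun p => ψ p.1) (fun p => f p.1 + c) (by fun_prop) (by fun_prop) hψ τ hτ
  set Y : Euc N × ℝ → ℝ := fun q => θ q.2 * A q + (1 - θ q.2) * B q with hY
  have hY2 : ContDiff ℝ 2 Y := tconv_contDiff hA2 hB2 hθ2
  set φ : Euc N × ℝ → ℝ := fun q => (fun _ : ℝ => 1 - ν) q.2 * Y q + (1 - (fun _ : ℝ => 1 - ν) q.2) * ζ q with hφ
  have hφ2 : ContDiff ℝ 2 φ := tconv_contDiff hY2 hζ2 contDiff_const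
  have hφe : ∀ q, φ q = (1 - ν) * Y q + ν * ζ q := fun q => by simp [hφ]
  have hθ01 : ∀ s, 0 ≤ s → 0 ≤ θ s ∧ θ s ≤ 1 := fun s hs => by
    have h3 : Real.exp (-(δ * s)) ≤ 1 := Real.exp_le_one_iff.2 (by nlinarith)
    have h4 := Real.exp_pos (-(δ * s))
    simp only [hθ]; constructor <;> linarith
  have hpos : ∀ q ∈ closedBall p r, 0 < q.2 := fun q hq => by
    have h3 : |q.2 - t₀| ≤ r := (le_max_right (dist q.1 x₀) (dist q.2 t₀)).trans hq
    linarith [(abs_le.1 h3).1]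
  have hYz : ∀ q ∈ closedBall p r ∩ closure Ω ×ˢ Iic t₀, |Y q - z q| ≤ τ := by
    intro q hq
    obtain ⟨a1, a2⟩ := hθ01 q.2 (hpos q hq.1).le
    have a3 := abs_le.1 (hA q hq).1
    have a4 := abs_le.1 (hB q hq).1
    simp only [hY, hz]
    rw [abs_le]; constructor <;> nlinarith
  have hζp : ζ p = z p := by simp [hζ, qd_self]
  have hpQ : p ∈ closedBall p r ∩ closure Ω ×ˢ Iic t₀ := ⟨mem_closedBall_self hr.le, hx₀, le_refl t₀⟩
  obtain ⟨x', hx', t', ht', hd, hl, hle⟩ := loc_max isClosed_closure hx₀ t₀ hr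
    (k := fun q => φ q - v2 q) (hφ2.continuous.sub hv2) (fun q hq hqr => by
      have hqb : q ∈ closedBall p r := by rw [mem_closedBall]; exact hqr.le
      have a1 := abs_le.1 (hYz q ⟨hqb, hq⟩)
      have a2 := abs_le.1 (hYz p hpQ)
      have a3 := hmax' q hq (hpos q hqb).le
      have a4 := abs_le.1 (hZb q hqb)
      have a5 := abs_le.1 (hZb p hpQ.1)
      have a6 := qd_ge (a := p) (q := q)
      rw [hp, hqr, ← hp] at a6
      have a7 := mul_le_mul_of_nonneg_left a6 hκ0.le
      have a8 : ζ q ≤ z q - 1 := by simp only [hζ]; linarith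
      have b1 : φ q ≤ z q + τ - ν := by rw [hφe]; nlinarith
      have b2 : z p - τ ≤ φ p := by rw [hφe, hζp]; nlinarith
      show φ q - v2 q < φ p - v2 p
      linarith)
  change φ p - v2 p ≤ φ (x', t') - v2 (x', t') at hle
  set q : Euc N × ℝ := (x', t') with hq
  have hqb : q ∈ closedBall p r := ball_subset_closedBall hd
  have hqQ : q ∈ closedBall p r ∩ closure Ω ×ˢ Iic t₀ := ⟨hqb, hx', ht'⟩
  have ht0 : 0 < t' := hpos q hqb
  obtain ⟨k1, k2⟩ := hθ01 t' ht0.le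
  have a1 := abs_le.1 (hYz q hqQ)
  have a2 := abs_le.1 (hYz p hpQ)
  have a4 := abs_le.1 (hZb q hqb)
  have a5 := abs_le.1 (hZb p hpQ.1)
  have b2 : z p - τ ≤ φ p := by rw [hφe, hζp]; nlinarith
  have hζq : ζ q ≤ z q + 2 * Zb := by
    have : 0 ≤ κ * qd p q := mul_nonneg hκ0.le (qd_nonneg p q)
    simp only [hζ]; linarith
  have b1 : φ q ≤ z q + τ + 2 * Zb * ν := by rw [hφe]; nlinarith
  have hmin : IsLocalMinOn (fun q => v2 q - φ q) (closure Ω ×ˢ Iic t') (x', t') := by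
    have := hl.neg
    simpa using this
  rcases h2 φ hφ2 x' hx' t' ht0 hmin with h3 | ⟨h3, h4⟩
  · have c1 := Pop_tconv hm hY2 hζ2 (θ := fun _ => 1 - ν) contDiff_const q (by simp; linarith) (by simp; linarith)
    have c2 := Pop_tconv hm hA2 hB2 hθ2 q k1 k2
    change Pop m φ q ≤ _ at c1
    simp only [deriv_const, zero_mul, add_zero, sub_sub_cancel] at c1
    change Pop m Y q ≤ _ at c2
    obtain ⟨d1, d2⟩ := hA q hqQ
    obtain ⟨d3, d4⟩ := hB q hqQ
    have d1 := abs_le.1 d1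
    have d3 := abs_le.1 d3
    have d5 := (abs_le.1 (hK q hqb)).2
    have d6 := abs_le.1 (hFb q hqb)
    simp only [Function.comp] at d6
    have d7 := hδ1 x' hx' t' ht0.le
    set e := Real.exp (-(δ * t')) with he
    have hee : e0 ≤ e := Real.exp_le_exp.2 (by nlinarith [show t' ≤ t₀ from ht'])
    have hθe : θ q.2 = 1 - e := by simp only [hθ, hq, he]
    rw [hθd, hθe] at c2
    change f q.1 ≤ Pop m φ q at h3
    change δ * (v1 q - ψ q.1) ≤ -c / 4 at d7
    have hep : 0 < e := Real.exp_pos _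
    have he1 : e ≤ 1 := by rw [hθe] at *; simp only [hq] at hθe; linarith
    have g1 : δ * (A q - B q) ≤ -c / 2 := by
      have := mul_le_mul_of_nonneg_left (show A q - B q ≤ v1 q - ψ q.1 + 2 * τ by linarith [d1.2, d3.1]) hδ.le
      linarith
    have g2 : Pop m Y q ≤ f q.1 + e0 * c / 4 := by
      have g3 : δ * Real.exp (-(δ * q.2)) * (A q - B q) ≤ e * (-c / 2) := by
        have : δ * Real.exp (-(δ * q.2)) * (A q - B q) = e * (δ * (A q - B q)) := by
          simp only [he, hq]; ring
        rw [this]; gcongr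
      have g4 : (1 - e) * Pop m A q ≤ (1 - e) * (f q.1 + τ) := by
        apply mul_le_mul_of_nonneg_left d2; linarith
      have g5 : (1 - (1 - e)) * Pop m B q ≤ (1 - (1 - e)) * (f q.1 + c + τ) := by
        apply mul_le_mul_of_nonneg_left d4; linarith
      have g6 : e * c ≤ e0 * c := mul_le_mul_of_nonpos_right hee hc.le
      linarith
    have g7 : (1 - ν) * Pop m Y q ≤ (1 - ν) * (f q.1 + e0 * c / 4) := by
      apply mul_le_mul_of_nonneg_left g2; linarith
    have g8 : ν * Pop m ζ q ≤ ν * K := by gcongr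
    have g9 : -(ν * f q.1) ≤ ν * Fb := by
      have := mul_le_mul_of_nonneg_left (show -f q.1 ≤ Fb by linarith [d6.1]) hν.le
      linarith
    have g10 : (1 - ν) * (e0 * c / 4) ≤ e0 * c / 8 := by
      have := mul_nonneg (show 0 ≤ 1 / 2 - ν by linarith) hec.le
      linarith
    linarith
  · have c1 : z q ≤ g x' := by
      have c3 := hb1 x' h3 t' ht0
      have c4 := hψg x' h3
      simp only [hz, hq]
      have c5 := mul_le_mul_of_nonneg_left c3 k1
      have c6 := mul_le_mul_of_nonneg_left c4 (sub_nonneg.2 k2)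
      linarith
    change g x' ≤ v2 q at h4
    linarith
end
end

open Set Filter Topology Metric MeasureTheory

noncomputable section

lemma tietze {X : Type*} [TopologicalSpace X] [NormalSpace X] {s : Set X} (hs : IsClosed s) {f : X → ℝ}
    (hf : ContinuousOn f s) : ∃ F : X → ℝ, Continuous F ∧ EqOn F f s := by
  obtain ⟨F, hF⟩ := ContinuousMap.exists_restrict_eq hs ⟨s.domRestrict f, hf.domRestrict⟩
  refine ⟨F, F.continuous, fun x hx => ?_⟩
  have := congrArg (fun k => k ⟨x, hx⟩) hF
  exact this

section
variable {N : ℕ} {Ω : Set (Euc N)} {m : ℝ}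

lemma PSub.congr {f f' g : Euc N → ℝ} {v : Euc N × ℝ → ℝ} (h : PSub Ω m f g v)
    (hff : EqOn f' f (closure Ω)) : PSub Ω m f' g v := fun φ hφ x hx t ht hl => by
  rw [hff hx]; exact h φ hφ x hx t ht hl

lemma PSup.congr {f f' g : Euc N → ℝ} {v : Euc N × ℝ → ℝ} (h : PSup Ω m f g v)
    (hff : EqOn f' f (closure Ω)) : PSup Ω m f' g v := fun φ hφ x hx t ht hl => by
  rw [hff hx]; exact h φ hφ x hx t ht hl

theorem gcomp (hΩ : IsOpen Ω) (hb : Bornology.IsBounded Ω) (hC2 : HasC2Boundary Ω)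
    (hm : 2 < m) {f g W : Euc N → ℝ} (hf : Continuous f) (hg : ContinuousOn g (frontier Ω))
    (hWc : Continuous W) {c : ℝ} (hc : c < 0)
    (hW : ∀ a, HJSub m (Ω ×ˢ Ioi 0) (fun p => f p.1 + c) (fun p => W p.1 - a))
    {M : ℝ} (hgM : ∀ x ∈ frontier Ω, |g x| ≤ M) (hM : 0 ≤ M) :
    ∃ δ > 0, ∃ D > 0, ∃ ψ : Euc N → ℝ, (∀ x ∈ closure Ω, -D ≤ ψ x) ∧
      ∀ v1 v2 : Euc N × ℝ → ℝ, Continuous v1 → Continuous v2 → PSub Ω m f g v1 → PSup Ω m f g v2 →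
      (∀ x ∈ closure Ω, ∀ t, 0 ≤ t → v1 (x, t) ≤ M) → (∀ x ∈ closure Ω, -M ≤ v2 (x, 0)) →
      ∀ x ∈ closure Ω, ∀ t, 0 ≤ t →
        (1 - Real.exp (-(δ * t))) * v1 (x, t) + Real.exp (-(δ * t)) * ψ x ≤ v2 (x, t) ∧
        v1 (x, t) - v2 (x, t) ≤ D * Real.exp (-(δ * t)) := by
  obtain ⟨Wb, hWb⟩ := hb.isCompact_closure.exists_bound_of_continuousOn hWc.continuousOn
  obtain ⟨D, hD0, hD⟩ : ∃ D > 0, 2 * M + 2 * Wb ≤ D := ⟨max (2 * M + 2 * Wb) 1, by positivity, le_max_left _ _⟩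
  have hψ1 : ∀ x ∈ closure Ω, W x - (Wb + M) ≤ -M := fun x hx => by
    have := (abs_le.1 (hWb x hx)).2
    linarith
  have hψ2 : ∀ x ∈ closure Ω, M - D ≤ W x - (Wb + M) := fun x hx => by
    have := (abs_le.1 (hWb x hx)).1
    linarith
  have hδ : 0 < -c / 4 / D := by
    have : 0 < -c := by linarith
    positivity
  refine ⟨-c / 4 / D, hδ, D, hD0, fun x => W x - (Wb + M), fun x hx => by linarith [hψ2 x hx],
    fun v1 v2 hv1 hv2 h1 h2 hvM hv20 x hx t ht => ?_⟩
  have key := comp hΩ hb hC2 hm hf (ψ := fun x => W x - (Wb + M)) (by fun_prop) hc hv1 hv2 (h1.hj hΩ)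
    (fun x hx t ht => bl hΩ hC2 hm hf hg hv1 h1 hx ht) h2 (hW _)
    (fun x hx => by
      have := (abs_le.1 (hgM x hx)).1
      linarith [hψ1 x (frontier_subset_closure hx)])
    (fun x hx => by linarith [hψ1 x hx, hv20 x hx]) hδ
    (fun x hx t ht => by
      have h3 : v1 (x, t) - (W x - (Wb + M)) ≤ D := by linarith [hψ2 x hx, hvM x hx t ht]
      calc -c / 4 / D * (v1 (x, t) - (W x - (Wb + M))) ≤ -c / 4 / D * D := by gcongr
        _ = -c / 4 := by field_simp) hx ht
  refine ⟨key, ?_⟩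
  have h3 : v1 (x, t) - (W x - (Wb + M)) ≤ D := by linarith [hψ2 x hx, hvM x hx t ht]
  have h4 := mul_le_mul_of_nonneg_right h3 (Real.exp_pos (-(-c / 4 / D * t))).le
  linarith

lemma PopΦ {φ : Euc N → ℝ} (hφ : ContDiff ℝ 2 φ) (x₀ : Euc N) (κ : ℝ) :
    ContDiff ℝ 2 (fun q : Euc N × ℝ => φ q.1 + κ * qd (x₀, 1) q) ∧
    Pop m (fun q : Euc N × ℝ => φ q.1 + κ * qd (x₀, 1) q) (x₀, 1) =
      - lapl φ x₀ + ‖gradient φ x₀‖ ^ m - κ * (2 * N) := by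
  have e1 : ContDiff ℝ 2 (fun q : Euc N × ℝ => φ q.1) := hφ.comp contDiff_fst
  have e2 : ContDiff ℝ 2 (fun q : Euc N × ℝ => κ * qd (x₀, 1) q) := contDiff_const.mul (qd_contDiff _)
  refine ⟨e1.add e2, ?_⟩
  unfold Pop
  rw [dtE_add e1 e2, grE_add e1 e2, lpE_add e1 e2, dtE_cmul _ (qd_contDiff _), grE_cmul _ (qd_contDiff _),
    lpE_cmul _ (qd_contDiff _), dtE_qd, grE_qd, lpE_qd]
  obtain ⟨a1, a2, a3⟩ := space_fun (k := φ) (x₀, (1:ℝ))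
  rw [a1, a2, a3]
  simp
  ring

lemma small_exp {D δ : ℝ} (hδ : 0 < δ) : Tendsto (fun t : ℝ => D * Real.exp (-(δ * t))) atTop (𝓝 0) := by
  have h1 : Tendsto (fun t : ℝ => δ * t) atTop atTop := tendsto_id.const_mul_atTop hδ
  have := (Real.tendsto_exp_neg_atTop_nhds_zero.comp h1).const_mul D
  simpa using this

lemma stab_sup (hm : 2 < m) {f g : Euc N → ℝ} (hf : Continuous f) (hg : ContinuousOn g (frontier Ω))
    {U : Euc N × ℝ → ℝ} (hU : Continuous U) (hs : PSup Ω m f g U) {u2 : Euc N → ℝ}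
    (hu2 : ContinuousOn u2 (closure Ω)) {D δ : ℝ} (hδ : 0 < δ) (hD : 0 < D)
    (hconv : ∀ x ∈ closure Ω, ∀ t, 0 ≤ t → |U (x, t) - u2 x| ≤ D * Real.exp (-(δ * t)))
    {φ : Euc N → ℝ} (hφ : ContDiff ℝ 2 φ) {x₀ : Euc N} (hx₀ : x₀ ∈ closure Ω)
    (hl : IsLocalMinOn (u2 - φ) (closure Ω) x₀) :
    f x₀ ≤ - lapl φ x₀ + ‖gradient φ x₀‖ ^ m ∨ (x₀ ∈ frontier Ω ∧ g x₀ ≤ u2 x₀) := by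
  by_contra hcon
  push Not at hcon
  obtain ⟨h1, h2⟩ := hcon
  obtain ⟨κ, hκ, hκ1⟩ : ∃ κ > 0, κ * (2 * N) < f x₀ - (- lapl φ x₀ + ‖gradient φ x₀‖ ^ m) := by
    refine ⟨(f x₀ - (- lapl φ x₀ + ‖gradient φ x₀‖ ^ m)) / (2 * N + 1), div_pos (by linarith) (by positivity), ?_⟩
    rw [div_mul_eq_mul_div, div_lt_iff₀ (by positivity)]
    nlinarith
  obtain ⟨hΦ, hPop⟩ := PopΦ (m := m) hφ x₀ (-κ)
  set Φ : Euc N × ℝ → ℝ := fun q => φ q.1 + -κ * qd (x₀, 1) q with hΦd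
  have e1 : ∀ᶠ q in 𝓝 (x₀, (1:ℝ)), Pop m Φ q < f q.1 :=
    (Pop_cont hm hΦ).continuousAt.eventually_lt (hf.comp continuous_fst).continuousAt
      (by simp only [Function.comp]; rw [hPop]; linarith)
  obtain ⟨r1, hr1, hR1⟩ := Metric.nhds_basis_closedBall.eventually_iff.1 e1
  have e2 : ∀ᶠ x in 𝓝 x₀, x ∈ closure Ω → (u2 - φ) x₀ ≤ (u2 - φ) x := eventually_nhdsWithin_iff.1 hl
  have e3 : ∃ η > 0, ∀ᶠ x in 𝓝 x₀, x ∈ frontier Ω → u2 x + η < g x := by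
    by_cases hxf : x₀ ∈ frontier Ω
    · have h3 := h2 hxf
      refine ⟨(g x₀ - u2 x₀) / 2, by linarith, eventually_nhdsWithin_iff.1 ?_⟩
      have h4 : ContinuousWithinAt (fun x => u2 x + (g x₀ - u2 x₀) / 2) (frontier Ω) x₀ :=
        ((hu2.mono frontier_subset_closure) x₀ hxf).add continuousWithinAt_const
      exact Tendsto.eventually_lt h4 (hg x₀ hxf) (by linarith)
    · refine ⟨1, one_pos, ?_⟩
      filter_upwards [isClosed_frontier.isOpen_compl.mem_nhds hxf] with x hx hx'
      exact absurd hx' hx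
  obtain ⟨η, hη, e3⟩ := e3
  obtain ⟨r2, hr2, hR2⟩ := Metric.nhds_basis_closedBall.eventually_iff.1 (e2.and e3)
  obtain ⟨r, hr, hrr1, hrr2, hr3⟩ : ∃ r > 0, r ≤ r1 ∧ r ≤ r2 ∧ r < 1 :=
    ⟨min r1 (min r2 (1 / 2)), by positivity, min_le_left _ _, (min_le_right _ _).trans (min_le_left _ _),
      ((min_le_right _ _).trans (min_le_right _ _)).trans_lt (by norm_num)⟩
  obtain ⟨τ, hτ, hτ1, hτ2⟩ : ∃ τ > 0, τ < η ∧ 2 * τ < κ * r ^ 2 := by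
    refine ⟨min (η / 2) (κ * r ^ 2 / 4), by positivity, (min_le_left _ _).trans_lt (by linarith), ?_⟩
    have := min_le_right (η / 2) (κ * r ^ 2 / 4)
    have : 0 < κ * r ^ 2 := by positivity
    linarith
  obtain ⟨n, hn0, hn⟩ := ((eventually_ge_atTop (0:ℝ)).and ((small_exp (D := D) hδ).eventually (gt_mem_nhds hτ))).exists
  have hVs := hs.shift hn0
  set V : Euc N × ℝ → ℝ := fun q => U (q + (0, n)) with hV
  have hVc : Continuous V := by rw [hV]; fun_prop
  have hpos : ∀ q ∈ closedBall (x₀, (1:ℝ)) r, 0 < q.2 := fun q hq => by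
    have h3 : |q.2 - 1| ≤ r := (le_max_right (dist q.1 x₀) (dist q.2 1)).trans hq
    linarith [(abs_le.1 h3).1]
  have hVu : ∀ q ∈ closedBall (x₀, (1:ℝ)) r, q.1 ∈ closure Ω → |V q - u2 q.1| ≤ τ := fun q hq hqx => by
    have h3 := hpos q hq
    have h4 := hconv q.1 hqx (q.2 + n) (by linarith)
    have h5 : V q = U (q.1, q.2 + n) := by simp only [hV]; congr 1; ext <;> simp
    rw [h5]
    refine h4.trans (le_trans ?_ hn.le)
    gcongr
    linarith
  have hpb : (x₀, (1:ℝ)) ∈ closedBall (x₀, (1:ℝ)) r := mem_closedBall_self hr.le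
  have hfst : ∀ q ∈ closedBall (x₀, (1:ℝ)) r, q.1 ∈ closedBall x₀ r2 := fun q hq =>
    ((le_max_left (dist q.1 x₀) (dist q.2 1)).trans hq).trans hrr2
  have hΦp : Φ (x₀, 1) = φ x₀ := by simp [hΦd, qd_self]
  obtain ⟨x, hx, t, ht, hd, hlm, hle⟩ := loc_max isClosed_closure hx₀ 1 hr
    (k := fun q => Φ q - V q) (hΦ.continuous.sub hVc) (fun q hq hqr => by
      have hqb : q ∈ closedBall (x₀, (1:ℝ)) r := by rw [mem_closedBall]; exact hqr.le
      have a1 := abs_le.1 (hVu q hqb hq.1)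
      have a2 := abs_le.1 (hVu _ hpb hx₀)
      have a3 := (hR2 (hfst q hqb)).1 hq.1
      simp only [Pi.sub_apply] at a3
      have a6 := qd_ge (a := (x₀, (1:ℝ))) (q := q)
      rw [hqr] at a6
      have a7 := mul_le_mul_of_nonneg_left a6 hκ.le
      have a8 : Φ q ≤ φ q.1 - κ * r ^ 2 := by simp only [hΦd]; linarith
      show Φ q - V q < Φ (x₀, 1) - V (x₀, 1)
      linarith)
  have hqb : (x, t) ∈ closedBall (x₀, (1:ℝ)) r := ball_subset_closedBall hd
  have hmin : IsLocalMinOn (fun q => V q - Φ q) (closure Ω ×ˢ Iic t) (x, t) := by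
    have := hlm.neg
    simpa using this
  rcases hVs Φ hΦ x hx t (hpos _ hqb) hmin with h3 | ⟨h3, h4⟩
  · have := hR1 (closedBall_subset_closedBall hrr1 hqb)
    simp only at this
    linarith
  · have h5 := (hR2 (hfst _ hqb)).2 h3
    have h6 := abs_le.1 (hVu _ hqb hx)
    change g x ≤ V (x, t) at h4
    simp only at h5 h6
    linarith

lemma stab_sub (hm : 2 < m) {f g : Euc N → ℝ} (hf : Continuous f) (hg : ContinuousOn g (frontier Ω))
    {U : Euc N × ℝ → ℝ} (hU : Continuous U) (hs : PSub Ω m f g U) {u2 : Euc N → ℝ}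
    (hu2 : ContinuousOn u2 (closure Ω)) {D δ : ℝ} (hδ : 0 < δ) (hD : 0 < D)
    (hconv : ∀ x ∈ closure Ω, ∀ t, 0 ≤ t → |U (x, t) - u2 x| ≤ D * Real.exp (-(δ * t)))
    {φ : Euc N → ℝ} (hφ : ContDiff ℝ 2 φ) {x₀ : Euc N} (hx₀ : x₀ ∈ closure Ω)
    (hl : IsLocalMaxOn (u2 - φ) (closure Ω) x₀) :
    - lapl φ x₀ + ‖gradient φ x₀‖ ^ m ≤ f x₀ ∨ (x₀ ∈ frontier Ω ∧ u2 x₀ ≤ g x₀) := by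
  by_contra hcon
  push Not at hcon
  obtain ⟨h1, h2⟩ := hcon
  obtain ⟨κ, hκ, hκ1⟩ : ∃ κ > 0, κ * (2 * N) < (- lapl φ x₀ + ‖gradient φ x₀‖ ^ m) - f x₀ := by
    refine ⟨((- lapl φ x₀ + ‖gradient φ x₀‖ ^ m) - f x₀) / (2 * N + 1), div_pos (by linarith) (by positivity), ?_⟩
    rw [div_mul_eq_mul_div, div_lt_iff₀ (by positivity)]
    nlinarith
  obtain ⟨hΦ, hPop⟩ := PopΦ (m := m) hφ x₀ κ
  set Φ : Euc N × ℝ → ℝ := fun q => φ q.1 + κ * qd (x₀, 1) q with hΦd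
  have e1 : ∀ᶠ q in 𝓝 (x₀, (1:ℝ)), f q.1 < Pop m Φ q :=
    (hf.comp continuous_fst).continuousAt.eventually_lt (Pop_cont hm hΦ).continuousAt
      (by simp only [Function.comp]; rw [hPop]; linarith)
  obtain ⟨r1, hr1, hR1⟩ := Metric.nhds_basis_closedBall.eventually_iff.1 e1
  have e2 : ∀ᶠ x in 𝓝 x₀, x ∈ closure Ω → (u2 - φ) x ≤ (u2 - φ) x₀ := eventually_nhdsWithin_iff.1 hl
  have e3 : ∃ η > 0, ∀ᶠ x in 𝓝 x₀, x ∈ frontier Ω → g x < u2 x - η := by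
    by_cases hxf : x₀ ∈ frontier Ω
    · have h3 := h2 hxf
      refine ⟨(u2 x₀ - g x₀) / 2, by linarith, eventually_nhdsWithin_iff.1 ?_⟩
      have h4 : ContinuousWithinAt (fun x => u2 x - (u2 x₀ - g x₀) / 2) (frontier Ω) x₀ :=
        ((hu2.mono frontier_subset_closure) x₀ hxf).sub continuousWithinAt_const
      exact Tendsto.eventually_lt (hg x₀ hxf) h4 (by linarith)
    · refine ⟨1, one_pos, ?_⟩
      filter_upwards [isClosed_frontier.isOpen_compl.mem_nhds hxf] with x hx hx'
      exact absurd hx' hx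
  obtain ⟨η, hη, e3⟩ := e3
  obtain ⟨r2, hr2, hR2⟩ := Metric.nhds_basis_closedBall.eventually_iff.1 (e2.and e3)
  obtain ⟨r, hr, hrr1, hrr2, hr3⟩ : ∃ r > 0, r ≤ r1 ∧ r ≤ r2 ∧ r < 1 :=
    ⟨min r1 (min r2 (1 / 2)), by positivity, min_le_left _ _, (min_le_right _ _).trans (min_le_left _ _),
      ((min_le_right _ _).trans (min_le_right _ _)).trans_lt (by norm_num)⟩
  obtain ⟨τ, hτ, hτ1, hτ2⟩ : ∃ τ > 0, τ < η ∧ 2 * τ < κ * r ^ 2 := by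
    refine ⟨min (η / 2) (κ * r ^ 2 / 4), by positivity, (min_le_left _ _).trans_lt (by linarith), ?_⟩
    have := min_le_right (η / 2) (κ * r ^ 2 / 4)
    have : 0 < κ * r ^ 2 := by positivity
    linarith
  obtain ⟨n, hn0, hn⟩ := ((eventually_ge_atTop (0:ℝ)).and ((small_exp (D := D) hδ).eventually (gt_mem_nhds hτ))).exists
  have hVs := hs.shift hn0
  set V : Euc N × ℝ → ℝ := fun q => U (q + (0, n)) with hV
  have hVc : Continuous V := by rw [hV]; fun_prop
  have hpos : ∀ q ∈ closedBall (x₀, (1:ℝ)) r, 0 < q.2 := fun q hq => by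
    have h3 : |q.2 - 1| ≤ r := (le_max_right (dist q.1 x₀) (dist q.2 1)).trans hq
    linarith [(abs_le.1 h3).1]
  have hVu : ∀ q ∈ closedBall (x₀, (1:ℝ)) r, q.1 ∈ closure Ω → |V q - u2 q.1| ≤ τ := fun q hq hqx => by
    have h3 := hpos q hq
    have h4 := hconv q.1 hqx (q.2 + n) (by linarith)
    have h5 : V q = U (q.1, q.2 + n) := by simp only [hV]; congr 1; ext <;> simp
    rw [h5]
    refine h4.trans (le_trans ?_ hn.le)
    gcongr
    linarith
  have hpb : (x₀, (1:ℝ)) ∈ closedBall (x₀, (1:ℝ)) r := mem_closedBall_self hr.le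
  have hfst : ∀ q ∈ closedBall (x₀, (1:ℝ)) r, q.1 ∈ closedBall x₀ r2 := fun q hq =>
    ((le_max_left (dist q.1 x₀) (dist q.2 1)).trans hq).trans hrr2
  have hΦp : Φ (x₀, 1) = φ x₀ := by simp [hΦd, qd_self]
  obtain ⟨x, hx, t, ht, hd, hlm, hle⟩ := loc_max isClosed_closure hx₀ 1 hr
    (k := fun q => V q - Φ q) (hVc.sub hΦ.continuous) (fun q hq hqr => by
      have hqb : q ∈ closedBall (x₀, (1:ℝ)) r := by rw [mem_closedBall]; exact hqr.le
      have a1 := abs_le.1 (hVu q hqb hq.1)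
      have a2 := abs_le.1 (hVu _ hpb hx₀)
      have a3 := (hR2 (hfst q hqb)).1 hq.1
      simp only [Pi.sub_apply] at a3
      have a6 := qd_ge (a := (x₀, (1:ℝ))) (q := q)
      rw [hqr] at a6
      have a7 := mul_le_mul_of_nonneg_left a6 hκ.le
      have a8 : φ q.1 + κ * r ^ 2 ≤ Φ q := by simp only [hΦd]; linarith
      show V q - Φ q < V (x₀, 1) - Φ (x₀, 1)
      linarith)
  have hqb : (x, t) ∈ closedBall (x₀, (1:ℝ)) r := ball_subset_closedBall hd
  rcases hVs Φ hΦ x hx t (hpos _ hqb) hlm with h3 | ⟨h3, h4⟩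
  · have := hR1 (closedBall_subset_closedBall hrr1 hqb)
    simp only at this
    linarith
  · have h5 := (hR2 (hfst _ hqb)).2 h3
    have h6 := abs_le.1 (hVu _ hqb hx)
    change V (x, t) ≤ g x at h4
    simp only at h5 h6
    linarith

end
end

open Set Filter Topology Metric MeasureTheory
/-- Long-time convergence when the ergodic constant is
negative, Theorem 4.1 (B)(i) of the paper. -/
theorem stmt17 {N : ℕ} (hN : 1 ≤ N) (Ω : Set (Euc N))
    (hΩo : IsOpen Ω) (hΩb : Bornology.IsBounded Ω) (hΩc : IsConnected Ω)
    (hΩ2 : HasC2Boundary Ω)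
    (m : ℝ) (hm : 2 < m)
    (f u₀ g : Euc N → ℝ)
    (hf : ContinuousOn f (closure Ω)) (hu₀ : ContinuousOn u₀ (closure Ω))
    (hg : ContinuousOn g (frontier Ω))
    (hcomp : ∀ x ∈ frontier Ω, u₀ x = g x)
    (u : Euc N → ℝ → ℝ) (hu : IsGlobalParSol Ω f g u₀ 0 m u)
    (c : ℝ)
    (hc : ∃ uInf : Euc N → ℝ,
      HolderOnCl ((m - 2) / (m - 1)) (closure Ω) uInf ∧
      LocLipIn Ω uInf ∧
      IsSCSolution Ω (fun x => f x + c) 0 m uInf)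
    (hcneg : c < 0) :
    (∃ C : ℝ, ∀ x ∈ closure Ω, ∀ t : ℝ, 0 ≤ t → |u x t| ≤ C) ∧
    ∃ u₂ : Euc N → ℝ, ContinuousOn u₂ (closure Ω) ∧
      (∃ C : ℝ, ∀ x ∈ closure Ω, |u₂ x| ≤ C) ∧
      IsStatSub Ω f g 0 m u₂ ∧ IsStatSuper Ω f g 0 m u₂ ∧
      (∀ w : Euc N → ℝ, ContinuousOn w (closure Ω) →
        (∃ C : ℝ, ∀ x ∈ closure Ω, |w x| ≤ C) →
        IsStatSub Ω f g 0 m w → IsStatSuper Ω f g 0 m w →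
        Set.EqOn w u₂ (closure Ω)) ∧
      TendstoUniformlyOn (fun t x => u x t) u₂ atTop (closure Ω) := by
  obtain ⟨F, hFc, hFf⟩ := tietze isClosed_closure hf
  obtain ⟨huc, hupar⟩ := id hu
  obtain ⟨U, hUc, hUu⟩ := tietze (isClosed_closure.prod isClosed_Ici) huc
  have hUe : ∀ x ∈ closure Ω, ∀ t, 0 ≤ t → U (x, t) = u x t := fun x hx t ht =>
    hUu (show (x, t) ∈ closure Ω ×ˢ Ici 0 from ⟨hx, ht⟩)
  obtain ⟨uInf, -, -, hsc⟩ := hc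
  obtain ⟨W, hWc, hWe⟩ := tietze isClosed_closure hsc.1
  have hHJ : ∀ a, HJSub m (Ω ×ˢ Ioi 0) (fun p => F p.1 + c) (fun p => W p.1 - a) := fun a =>
    sc_HJSub hΩo hsc hWe (H := fun x => F x + c) (fun x hx => by
      simp only [hFf (subset_closure hx)]) a
  have hsub : PSub Ω m F g U := (sol_PSub hΩo hu (fun q hq => hUu hq)).congr hFf
  have hsup : PSup Ω m F g U := (sol_PSup hΩo hu (fun q hq => hUu hq)).congr hFf
  have hU0 : ∀ x ∈ closure Ω, U (x, 0) = u₀ x := fun x hx => by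
    rw [hUe x hx 0 le_rfl]
    exact le_antisymm ((hupar 1 one_pos).1.2.1 x hx) ((hupar 1 one_pos).2.2.1 x hx)
  have hcompact := hΩb.isCompact_closure
  obtain ⟨B0, hB0⟩ := hcompact.exists_bound_of_continuousOn hu₀
  have hgB : ∀ x ∈ frontier Ω, |g x| ≤ B0 := fun x hx => by
    rw [← hcomp x hx]; exact hB0 x (frontier_subset_closure hx)
  have hUg : ∀ x ∈ frontier Ω, ∀ t > 0, U (x, t) ≤ g x := fun x hx t ht =>
    bl hΩo hΩ2 hm hFc hg hUc hsub hx ht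
  obtain ⟨C1, hC1⟩ := upper_bd hN hΩo hΩb hm hFc hUc hsub (B := B0)
    (fun x hx => by rw [hU0 x hx]; exact (abs_le.1 (hB0 x hx)).2)
    (fun x hx t ht => (hUg x hx t ht).trans (abs_le.1 (hgB x hx)).2)
  -- boundedness
  obtain ⟨M, hMU, hMB, hM0⟩ : ∃ M, (∀ x ∈ closure Ω, ∀ t, 0 ≤ t → |U (x, t)| ≤ M) ∧ B0 ≤ M ∧ 0 ≤ M := by
    set M0 := max (max B0 C1) 0 with hM0
    have b1 : B0 ≤ M0 := (le_max_left _ _).trans (le_max_left _ _)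
    have b2 : C1 ≤ M0 := (le_max_right _ _).trans (le_max_left _ _)
    obtain ⟨δ, hδ, D, hD, ψ, hψ, hG⟩ := gcomp hΩo hΩb hΩ2 hm hFc hg hWc hcneg hHJ
      (M := M0) (fun x hx => (hgB x hx).trans b1) (le_max_right _ _)
    have hlow : ∀ x ∈ closure Ω, ∀ t, 0 ≤ t → -D ≤ U (x, t) := fun x hx t ht => by
      have h1 := (hG U U hUc hUc hsub hsup (fun x hx t ht => (hC1 x hx t ht).trans b2)
        (fun x hx => by rw [hU0 x hx]; linarith [(abs_le.1 (hB0 x hx)).1]) x hx t ht).1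
      have h2 := Real.exp_pos (-(δ * t))
      have h3 : ψ x ≤ U (x, t) := by
        by_contra h4
        push Not at h4
        nlinarith
      exact (hψ x hx).trans h3
    refine ⟨max M0 D, fun x hx t ht => abs_le.2 ⟨?_, ?_⟩, b1.trans (le_max_left _ _),
      (le_max_right _ _).trans (le_max_left _ _)⟩
    · linarith [hlow x hx t ht, le_max_right M0 D]
    · exact ((hC1 x hx t ht).trans b2).trans (le_max_left _ _)
  -- Cauchy estimate
  obtain ⟨δ, hδ, D, hD, ψ, hψ, hG⟩ := gcomp hΩo hΩb hΩ2 hm hFc hg hWc hcneg hHJ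
    (M := M) (fun x hx => (hgB x hx).trans hMB) hM0
  have hsh : ∀ (h : ℝ) (x : Euc N) (t : ℝ), U ((x, t) + (0, h)) = U (x, t + h) := fun h x t => by
    simp
  have hcau : ∀ x ∈ closure Ω, ∀ t, 0 ≤ t → ∀ h, 0 ≤ h →
      |U (x, t + h) - U (x, t)| ≤ D * Real.exp (-(δ * t)) := by
    intro x hx t ht h hh
    have hVc : Continuous (fun q : Euc N × ℝ => U (q + (0, h))) := by fun_prop
    have h1 := (hG _ U hVc hUc (hsub.shift hh) hsup
      (fun x hx t ht => by rw [hsh]; exact (abs_le.1 (hMU x hx _ (by linarith))).2)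
      (fun x hx => (abs_le.1 (hMU x hx 0 le_rfl)).1) x hx t ht).2
    have h2 := (hG U _ hUc hVc hsub (hsup.shift hh)
      (fun x hx t ht => (abs_le.1 (hMU x hx t ht)).2)
      (fun x hx => by rw [hsh]; exact (abs_le.1 (hMU x hx _ (by linarith))).1) x hx t ht).2
    rw [hsh] at h1 h2
    rw [abs_le]; constructor <;> linarith
  have hlim : ∀ x, ∃ l, x ∈ closure Ω → Tendsto (fun t => U (x, t)) atTop (𝓝 l) := by
    intro x
    by_cases hx : x ∈ closure Ω
    · have : CauchySeq (fun t : ℝ => U (x, t)) := by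
        rw [Metric.cauchySeq_iff']
        intro ε hε
        obtain ⟨n, hn0, hn⟩ := ((eventually_ge_atTop (0:ℝ)).and
          ((small_exp (D := D) hδ).eventually (gt_mem_nhds hε))).exists
        refine ⟨n, fun k hk => ?_⟩
        have := hcau x hx n hn0 (k - n) (by linarith)
        rw [add_sub_cancel] at this
        exact this.trans_lt hn
      obtain ⟨l, hl⟩ := cauchySeq_tendsto_of_complete this
      exact ⟨l, fun _ => hl⟩
    · exact ⟨0, fun h => absurd h hx⟩
  choose u₂ hu₂ using hlim
  have hconv : ∀ x ∈ closure Ω, ∀ t, 0 ≤ t → |U (x, t) - u₂ x| ≤ D * Real.exp (-(δ * t)) := by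
    intro x hx t ht
    have h1 : Tendsto (fun s => |U (x, t) - U (x, s)|) atTop (𝓝 |U (x, t) - u₂ x|) :=
      (tendsto_const_nhds.sub (hu₂ x hx)).abs
    refine le_of_tendsto h1 ?_
    filter_upwards [eventually_ge_atTop t] with s hs
    have := hcau x hx t ht (s - t) (by linarith)
    rw [add_sub_cancel] at this
    rw [abs_sub_comm]; exact this
  have hunif : TendstoUniformlyOn (fun t x => U (x, t)) u₂ atTop (closure Ω) := by
    rw [Metric.tendstoUniformlyOn_iff]
    intro ε hε
    filter_upwards [eventually_ge_atTop (0:ℝ), (small_exp (D := D) hδ).eventually (gt_mem_nhds hε)]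
      with t ht h1 x hx
    rw [dist_comm]
    exact (hconv x hx t ht).trans_lt h1
  have hu₂c : ContinuousOn u₂ (closure Ω) :=
    hunif.continuousOn (Eventually.of_forall fun t => by fun_prop).frequently
  have hu₂M : ∀ x ∈ closure Ω, |u₂ x| ≤ M := fun x hx => by
    refine le_of_tendsto (hu₂ x hx).abs ?_
    filter_upwards [eventually_ge_atTop (0:ℝ)] with t ht
    exact hMU x hx t ht
  have hΩf : ∀ x ∈ Ω, x ∉ frontier Ω := fun x hx h => by
    rw [hΩo.frontier_eq] at h; exact h.2 hx
  refine ⟨⟨M, fun x hx t ht => by rw [← hUe x hx t ht]; exact hMU x hx t ht⟩, u₂, hu₂c, ⟨M, hu₂M⟩,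
    ⟨hu₂c.upperSemicontinuousOn, ?_⟩, ⟨hu₂c.lowerSemicontinuousOn, ?_⟩, ?_, ?_⟩
  · intro φ hφ x hx hl
    have h1 := stab_sub hm hFc hg hUc hsub hu₂c hδ hD hconv hφ hx hl
    rw [hFf hx] at h1
    unfold statOp
    refine ⟨fun hxi => ?_, fun hxf => ?_⟩
    · rcases h1 with h1 | h1
      · linarith
      · exact absurd h1.1 (hΩf x hxi)
    · rcases h1 with h1 | h1
      · exact min_le_of_left_le (by linarith)
      · exact min_le_of_right_le (by linarith [h1.2])
  · intro φ hφ x hx hl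
    have h1 := stab_sup hm hFc hg hUc hsup hu₂c hδ hD hconv hφ hx hl
    rw [hFf hx] at h1
    unfold statOp
    refine ⟨fun hxi => ?_, fun hxf => ?_⟩
    · rcases h1 with h1 | h1
      · linarith
      · exact absurd h1.1 (hΩf x hxi)
    · rcases h1 with h1 | h1
      · exact le_max_of_le_left (by linarith)
      · exact le_max_of_le_right (by linarith [h1.2])
  · rintro w hwc ⟨Cw, hCw⟩ hwsub hwsup x hx
    obtain ⟨w', hw'c, hw'e⟩ := tietze isClosed_closure hwc
    have p1 : PSub Ω m F g (fun q => w' q.1) := (stat_PSub hΩo hwsub hw'e).congr hFf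
    have p2 : PSup Ω m F g (fun q => w' q.1) := (stat_PSup hΩo hwsup hw'e).congr hFf
    obtain ⟨δ', hδ', D', hD', ψ', hψ', hG'⟩ := gcomp hΩo hΩb hΩ2 hm hFc hg hWc hcneg hHJ
      (M := max M Cw) (fun x hx => ((hgB x hx).trans hMB).trans (le_max_left _ _)) (hM0.trans (le_max_left _ _))
    have hwM : ∀ x ∈ closure Ω, |w' x| ≤ max M Cw := fun x hx => by
      rw [hw'e hx]; exact (hCw x hx).trans (le_max_right _ _)
    have hUM : ∀ x ∈ closure Ω, ∀ t, 0 ≤ t → |U (x, t)| ≤ max M Cw := fun x hx t ht =>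
      (hMU x hx t ht).trans (le_max_left _ _)
    have hwc' : Continuous (fun q : Euc N × ℝ => w' q.1) := by fun_prop
    have key : ∀ t, 0 ≤ t → |U (x, t) - w' x| ≤ D' * Real.exp (-(δ' * t)) := fun t ht => by
      have h1 := (hG' _ U hwc' hUc p1 hsup (fun x hx t ht => (abs_le.1 (hwM x hx)).2)
        (fun x hx => (abs_le.1 (hUM x hx 0 le_rfl)).1) x hx t ht).2
      have h2 := (hG' U _ hUc hwc' hsub p2 (fun x hx t ht => (abs_le.1 (hUM x hx t ht)).2)
        (fun x hx => (abs_le.1 (hwM x hx)).1) x hx t ht).2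
      simp only at h1 h2
      rw [abs_le]; constructor <;> linarith
    have h3 : |u₂ x - w' x| ≤ 0 := by
      refine le_of_tendsto_of_tendsto ((hu₂ x hx).sub tendsto_const_nhds).abs (small_exp (D := D') hδ') ?_
      filter_upwards [eventually_ge_atTop (0:ℝ)] with t ht
      exact key t ht
    have h4 := abs_nonpos_iff.1 h3
    rw [← hw'e hx]
    linarith
  · refine hunif.congr ?_
    filter_upwards [eventually_ge_atTop (0:ℝ)] with t ht x hx
    exact hUe x hx t ht
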